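/- arXiv:2312.00156 — 2 statements merged into one kernel-verified Lean document; each statement's English description precedes it below -/
import Mathlib

section
/- Let M and K be color Hopf subalgebras of a cocommutative color Hopf algebra A, with K normal in A. Then KM is a color Hopf subalgebra of A: it contains 1, is closed under multiplication, satisfies Δ(KM) ⊆ KM ⊗ KM, and S(KM) ⊆ KM. Consequently KM is the supremum K ∨ M of K and M in the lattice of color Hopf subalgebras of A. -/
open TensorProduct

namespace ColorHopfPaper

variable (k : Type*) [Field k] (G : Type*) [CommGroup G]

/-- The "middle interchange" map `(A⊗A)⊗(B⊗B) → (A⊗B)⊗(A⊗B)` built from a braiding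
`c : A⊗B → B⊗A` applied to the two middle factors. -/
noncomputable def midMap {A B : Type*} [AddCommGroup A] [Module k A]
    [AddCommGroup B] [Module k B] (c : A ⊗[k] B →ₗ[k] B ⊗[k] A) :
    (A ⊗[k] A) ⊗[k] (B ⊗[k] B) →ₗ[k] (A ⊗[k] B) ⊗[k] (A ⊗[k] B) :=
  (TensorProduct.assoc k A B (A ⊗[k] B)).symm.toLinearMap ∘ₗ
    (TensorProduct.map LinearMap.id
      ((TensorProduct.assoc k B A B).toLinearMap ∘ₗ
        (TensorProduct.map c LinearMap.id) ∘ₗ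
        (TensorProduct.assoc k A B B).symm.toLinearMap)) ∘ₗ
    (TensorProduct.assoc k A A (B ⊗[k] B)).toLinearMap


/-- Generic Hopf kernel `{x : x₁ ⊗ f(x₂) = x ⊗ 1}` of `f`, for a comultiplication `Δ`. -/
noncomputable def hkerGen {X B : Type*} [AddCommGroup X] [Module k X]
    [AddCommGroup B] [Module k B]
    (Δ : X →ₗ[k] X ⊗[k] X) (f : X →ₗ[k] B) (oneB : B) : Submodule k X :=
  LinearMap.ker (((TensorProduct.map LinearMap.id f) ∘ₗ Δ) -
    (TensorProduct.mk k X B).flip oneB)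

/-- A (cocommutative) color Hopf algebra: a cocommutative Hopf monoid in the symmetric
monoidal category of `G`-graded `k`-vector spaces, with braiding given by a
skew-symmetric bicharacter `φ`. -/
structure ColorHopfAlg (H : Type*) [AddCommGroup H] [Module k H] where
  φ : G → G → k
  φ_ne : ∀ g h : G, φ g h ≠ 0
  φ_mul_left : ∀ g h l : G, φ (g * h) l = φ g l * φ h l
  φ_mul_right : ∀ g h l : G, φ g (h * l) = φ g h * φ g l
  φ_skew : ∀ g h : G, φ g h * φ h g = 1
  grade : G → Submodule k H
  grade_top : ⨆ g : G, grade g = ⊤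
  mul : H ⊗[k] H →ₗ[k] H
  one : H
  comul : H →ₗ[k] H ⊗[k] H
  counit : H →ₗ[k] k
  antipode : H →ₗ[k] H
  braid : H ⊗[k] H →ₗ[k] H ⊗[k] H
  braid_apply : ∀ (g h : G) (x y : H), x ∈ grade g → y ∈ grade h →
    braid (x ⊗ₜ[k] y) = φ g h • (y ⊗ₜ[k] x)
  one_mem : one ∈ grade 1
  mul_mem : ∀ (g h : G) (x y : H), x ∈ grade g → y ∈ grade h →
    mul (x ⊗ₜ[k] y) ∈ grade (g * h)
  antipode_mem : ∀ (g : G) (x : H), x ∈ grade g → antipode x ∈ grade g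
  mul_assoc' : ∀ x y z : H,
    mul (mul (x ⊗ₜ[k] y) ⊗ₜ[k] z) = mul (x ⊗ₜ[k] mul (y ⊗ₜ[k] z))
  one_mul' : ∀ x : H, mul (one ⊗ₜ[k] x) = x
  mul_one' : ∀ x : H, mul (x ⊗ₜ[k] one) = x
  coassoc : (TensorProduct.assoc k H H H).toLinearMap ∘ₗ
      (TensorProduct.map comul LinearMap.id) ∘ₗ comul
      = (TensorProduct.map LinearMap.id comul) ∘ₗ comul
  counit_left : ∀ x : H,
    (TensorProduct.lid k H) ((TensorProduct.map counit LinearMap.id) (comul x)) = x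
  counit_right : ∀ x : H,
    (TensorProduct.rid k H) ((TensorProduct.map LinearMap.id counit) (comul x)) = x
  comul_one : comul one = one ⊗ₜ[k] one
  counit_one : counit one = 1
  counit_mul : ∀ x y : H, counit (mul (x ⊗ₜ[k] y)) = counit x * counit y
  comul_mul : comul ∘ₗ mul =
    (TensorProduct.map mul mul) ∘ₗ midMap k braid ∘ₗ (TensorProduct.map comul comul)
  cocomm : braid ∘ₗ comul = comul
  antipode_left : ∀ x : H,
    mul ((TensorProduct.map antipode LinearMap.id) (comul x)) = counit x • one
  antipode_right : ∀ x : H,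
    mul ((TensorProduct.map LinearMap.id antipode) (comul x)) = counit x • one

namespace ColorHopfAlg

variable {k G}
variable {H : Type*} [AddCommGroup H] [Module k H] (C : ColorHopfAlg k G H)

/-- An element is homogeneous if it lies in one of the graded components. -/
def homogeneous (x : H) : Prop := ∃ g : G, x ∈ C.grade g

/-- The (color) adjoint action `ξ(a ⊗ b) = φ(|a₂|,|b|) a₁ b S(a₂)`. -/
noncomputable def adj : H ⊗[k] H →ₗ[k] H :=
  C.mul ∘ₗ
    (TensorProduct.map LinearMap.id
      (C.mul ∘ₗ (TensorProduct.map LinearMap.id C.antipode) ∘ₗ C.braid)) ∘ₗ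
    (TensorProduct.assoc k H H H).toLinearMap ∘ₗ
    (TensorProduct.map C.comul LinearMap.id)

/-- The commutator `[x,y] = φ(|x₂|,|y₁|) x₁y₁S(x₂)S(y₂) = (x ▷ y₁) S(y₂)`. -/
noncomputable def commMap : H ⊗[k] H →ₗ[k] H :=
  C.mul ∘ₗ (TensorProduct.map C.adj C.antipode) ∘ₗ
    (TensorProduct.assoc k H H H).symm.toLinearMap ∘ₗ
    (TensorProduct.map LinearMap.id C.comul)

/-- The comultiplication of the tensor-product (product) coalgebra `H ⊗ H`:
`x ⊗ y ↦ φ(|x₂|,|y₁|) (x₁⊗y₁)⊗(x₂⊗y₂)`. -/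
noncomputable def comul2 : H ⊗[k] H →ₗ[k] (H ⊗[k] H) ⊗[k] (H ⊗[k] H) :=
  midMap k C.braid ∘ₗ TensorProduct.map C.comul C.comul

/-- The counit of the tensor-product coalgebra `H ⊗ H`. -/
noncomputable def counit2 : H ⊗[k] H →ₗ[k] k :=
  (TensorProduct.lid k k).toLinearMap ∘ₗ TensorProduct.map C.counit C.counit

/-- `V` is a (graded) color Hopf subalgebra of `H`. -/
structure IsCHSub (V : Submodule k H) : Prop where
  one_mem : C.one ∈ V
  mul_mem : ∀ x ∈ V, ∀ y ∈ V, C.mul (x ⊗ₜ[k] y) ∈ V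
  comul_mem : ∀ x ∈ V,
    C.comul x ∈ LinearMap.range (TensorProduct.map V.subtype V.subtype)
  antipode_mem : ∀ x ∈ V, C.antipode x ∈ V
  graded : ∀ x ∈ V, x ∈ Submodule.span k {y : H | y ∈ V ∧ ∃ g : G, y ∈ C.grade g}

/-- `V` is normal: closed under the adjoint action of all of `H`. -/
def IsNormal (V : Submodule k H) : Prop :=
  ∀ a : H, ∀ x ∈ V, C.adj (a ⊗ₜ[k] x) ∈ V

/-- The subalgebra (as a submodule) generated by a set. -/
def genFrom (Sgen : Set H) : Submodule k H :=
  sInf {V : Submodule k H |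
    Sgen ⊆ ↑V ∧ C.one ∈ V ∧ ∀ x ∈ V, ∀ y ∈ V, C.mul (x ⊗ₜ[k] y) ∈ V}

/-- The commutator subalgebra `[X,Y]`, generated by all `[x,y]` with `x ∈ V`, `y ∈ W`. -/
def commSub (V W : Submodule k H) : Submodule k H :=
  C.genFrom {z : H | ∃ x ∈ V, ∃ y ∈ W, z = C.commMap (x ⊗ₜ[k] y)}

/-- The graded subspace `VW` spanned by products `vw`. -/
def prodSpan (V W : Submodule k H) : Submodule k H :=
  Submodule.span k {z : H | ∃ x ∈ V, ∃ y ∈ W, z = C.mul (x ⊗ₜ[k] y)}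

/-- The Hopf kernel `Hker(f) = {x : x₁ ⊗ f(x₂) = x ⊗ 1}` of a map `f : H → B`. -/
noncomputable def hkerOf {B : Type*} [AddCommGroup B] [Module k B]
    (CB : ColorHopfAlg k G B) (f : H →ₗ[k] B) : Submodule k H :=
  LinearMap.ker
    (((TensorProduct.map LinearMap.id f) ∘ₗ C.comul) -
      (TensorProduct.mk k H B).flip CB.one)

end ColorHopfAlg

/-- A morphism of color Hopf algebras. -/
structure IsColorHom {A B : Type*} [AddCommGroup A] [Module k A]
    [AddCommGroup B] [Module k B]
    (CA : ColorHopfAlg k G A) (CB : ColorHopfAlg k G B) (f : A →ₗ[k] B) : Prop where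
  map_mul : ∀ x y : A, f (CA.mul (x ⊗ₜ[k] y)) = CB.mul (f x ⊗ₜ[k] f y)
  map_one : f CA.one = CB.one
  map_comul : CB.comul ∘ₗ f = (TensorProduct.map f f) ∘ₗ CA.comul
  map_counit : CB.counit ∘ₗ f = CA.counit
  map_grade : ∀ g : G, ∀ x ∈ CA.grade g, f x ∈ CB.grade g

/-- A color Hopf crossed module `(A, H, d)`. -/
structure ColorCrossedMod {A H : Type*} [AddCommGroup A] [Module k A]
    [AddCommGroup H] [Module k H]
    (CA : ColorHopfAlg k G A) (CH : ColorHopfAlg k G H) where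
  cAH : A ⊗[k] H →ₗ[k] H ⊗[k] A
  cHA : H ⊗[k] A →ₗ[k] A ⊗[k] H
  cAH_apply : ∀ (g h : G) (a : A) (x : H), a ∈ CA.grade g → x ∈ CH.grade h →
    cAH (a ⊗ₜ[k] x) = CA.φ g h • (x ⊗ₜ[k] a)
  cHA_apply : ∀ (g h : G) (x : H) (a : A), x ∈ CH.grade g → a ∈ CA.grade h →
    cHA (x ⊗ₜ[k] a) = CH.φ g h • (a ⊗ₜ[k] x)
  φ_eq : CH.φ = CA.φ
  act : A ⊗[k] H →ₗ[k] H
  act_one_left : ∀ x : H, act (CA.one ⊗ₜ[k] x) = x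
  act_act : ∀ (a b : A) (x : H),
    act (a ⊗ₜ[k] act (b ⊗ₜ[k] x)) = act (CA.mul (a ⊗ₜ[k] b) ⊗ₜ[k] x)
  act_one : ∀ a : A, act (a ⊗ₜ[k] CH.one) = CA.counit a • CH.one
  counit_act : ∀ (a : A) (x : H),
    CH.counit (act (a ⊗ₜ[k] x)) = CA.counit a * CH.counit x
  comul_act : CH.comul ∘ₗ act =
    (TensorProduct.map act act) ∘ₗ midMap k cAH ∘ₗ
      (TensorProduct.map CA.comul CH.comul)
  act_mul : act ∘ₗ (TensorProduct.map LinearMap.id CH.mul) =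
    CH.mul ∘ₗ (TensorProduct.map act act) ∘ₗ midMap k cAH ∘ₗ
      (TensorProduct.map CA.comul LinearMap.id)
  act_grade : ∀ (g h : G) (a : A) (x : H), a ∈ CA.grade g → x ∈ CH.grade h →
    act (a ⊗ₜ[k] x) ∈ CH.grade (g * h)
  d : H →ₗ[k] A
  d_hom : IsColorHom k G CH CA d
  peiffer₁ : d ∘ₗ act = CA.adj ∘ₗ (TensorProduct.map LinearMap.id d)
  peiffer₂ : act ∘ₗ (TensorProduct.map d LinearMap.id) = CH.adj

namespace ColorCrossedMod

variable {k G}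
variable {A H : Type*} [AddCommGroup A] [Module k A] [AddCommGroup H] [Module k H]
variable {CA : ColorHopfAlg k G A} {CH : ColorHopfAlg k G H}

/-- The multiplication of the semi-direct (smash) product `H ⋊ A`:
`(h⊗a)(h'⊗a') = φ(|a₂|,|h'|) h (a₁·h') ⊗ a₂a'`. -/
noncomputable def smashMul (M : ColorCrossedMod k G CA CH) : (H ⊗[k] A) ⊗[k] (H ⊗[k] A) →ₗ[k] H ⊗[k] A :=
  (TensorProduct.map CH.mul CA.mul) ∘ₗ
  (TensorProduct.assoc k (H ⊗[k] H) A A).toLinearMap ∘ₗ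
  (TensorProduct.map (TensorProduct.assoc k H H A).symm.toLinearMap LinearMap.id) ∘ₗ
  (TensorProduct.map
    (TensorProduct.map LinearMap.id (TensorProduct.map M.act LinearMap.id))
    LinearMap.id) ∘ₗ
  (TensorProduct.map
    ((TensorProduct.map LinearMap.id
        ((TensorProduct.assoc k A H A).symm.toLinearMap ∘ₗ
          (TensorProduct.map LinearMap.id M.cAH) ∘ₗ
          (TensorProduct.assoc k A A H).toLinearMap)) ∘ₗ
      (TensorProduct.assoc k H (A ⊗[k] A) H).toLinearMap)
    LinearMap.id) ∘ₗ
  (TensorProduct.assoc k (H ⊗[k] (A ⊗[k] A)) H A).symm.toLinearMap ∘ₗ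
  (TensorProduct.map (TensorProduct.map LinearMap.id CA.comul) LinearMap.id)

/-- The comultiplication of `H ⋊ A` (tensor-product coalgebra twisted by `φ`). -/
noncomputable def smashComul (M : ColorCrossedMod k G CA CH) : H ⊗[k] A →ₗ[k] (H ⊗[k] A) ⊗[k] (H ⊗[k] A) :=
  midMap k M.cHA ∘ₗ TensorProduct.map CH.comul CA.comul

/-- The counit of `H ⋊ A`. -/
noncomputable def smashCounit (_M : ColorCrossedMod k G CA CH) : H ⊗[k] A →ₗ[k] k :=
  (TensorProduct.lid k k).toLinearMap ∘ₗ TensorProduct.map CH.counit CA.counit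

end ColorCrossedMod


namespace ColorHopfAlg

section Helpers

variable {k G}
variable {H : Type*} [AddCommGroup H] [Module k H] (C : ColorHopfAlg k G H)

theorem phi_one_left (h : G) : C.φ 1 h = 1 := by
  have h1 := C.φ_mul_left 1 1 h
  rw [mul_one] at h1
  have h2 := C.φ_ne 1 h
  exact (mul_left_cancel₀ h2 (by rw [mul_one]; exact h1)).symm

/-- Induction over homogeneous elements. -/
theorem hom_induction {p : H → Prop} (x : H) (h0 : p 0)
    (hadd : ∀ x y, p x → p y → p (x + y)) (hg : ∀ g, ∀ x ∈ C.grade g, p x) : p x := by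
  have hx : x ∈ ⨆ g : G, C.grade g := by rw [C.grade_top]; trivial
  exact Submodule.iSup_induction C.grade (motive := p) hx hg h0 hadd

/-- Twisting by a nonzero homogeneous element. -/
theorem exists_sigma (h : G) (y : H) (hy : y ∈ C.grade h) (hy0 : y ≠ 0) :
    ∃ σ : H →ₗ[k] H, (∀ x, C.braid (x ⊗ₜ[k] y) = y ⊗ₜ[k] σ x) ∧
      (∀ a b, σ (C.mul (a ⊗ₜ[k] b)) = C.mul (σ a ⊗ₜ[k] σ b)) ∧
      (∀ a, σ (C.antipode a) = C.antipode (σ a)) ∧ σ C.one = C.one ∧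
      (∀ g, ∀ x ∈ C.grade g, σ x = C.φ g h • x) := by
  obtain ⟨f, hf⟩ := Module.Projective.exists_dual_ne_zero k hy0
  let σ : H →ₗ[k] H := (f y)⁻¹ • ((TensorProduct.lid k H).toLinearMap ∘ₗ
    (TensorProduct.map f LinearMap.id) ∘ₗ C.braid ∘ₗ (TensorProduct.mk k H H).flip y)
  have hσ : ∀ g, ∀ x ∈ C.grade g, σ x = C.φ g h • x := by
    intro g x hx
    simp only [σ, LinearMap.smul_apply, LinearMap.comp_apply, LinearMap.flip_apply,
      TensorProduct.mk_apply, C.braid_apply g h x y hx hy, map_smul, TensorProduct.map_tmul,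
      LinearEquiv.coe_coe, TensorProduct.lid_tmul, LinearMap.id_apply]
    rw [smul_comm, smul_smul (f y)⁻¹, inv_mul_cancel₀ hf, one_smul]
  refine ⟨σ, ?_, ?_, ?_, ?_, hσ⟩
  · intro x
    induction x using C.hom_induction with
    | h0 => simp
    | hadd x y hx hy => simp only [TensorProduct.add_tmul, TensorProduct.tmul_add, map_add, hx, hy]
    | hg g x hx => rw [C.braid_apply g h x y hx hy, hσ g x hx, TensorProduct.tmul_smul]
  · intro a b
    induction a using C.hom_induction with
    | h0 => simp
    | hadd x y hx hy => simp only [TensorProduct.add_tmul, map_add, hx, hy]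
    | hg g a ha =>
      induction b using C.hom_induction with
      | h0 => simp
      | hadd x y hx hy => simp only [TensorProduct.tmul_add, map_add, hx, hy]
      | hg g' b hb =>
        rw [hσ _ _ (C.mul_mem g g' a b ha hb), hσ _ _ ha, hσ _ _ hb, C.φ_mul_left,
          TensorProduct.smul_tmul_smul, map_smul]
  · intro a
    induction a using C.hom_induction with
    | h0 => simp
    | hadd x y hx hy => simp only [map_add, hx, hy]
    | hg g a ha => rw [hσ _ _ (C.antipode_mem g a ha), hσ _ _ ha, map_smul]
  · rw [hσ _ _ C.one_mem, C.phi_one_left, one_smul]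

/-- Coassociativity in usable form. -/
theorem coassoc_apply {N : Type*} [AddCommGroup N] [Module k N]
    (F : H ⊗[k] (H ⊗[k] H) →ₗ[k] N) (x : H) :
    F (TensorProduct.assoc k H H H (TensorProduct.map C.comul LinearMap.id (C.comul x))) =
      F (TensorProduct.map LinearMap.id C.comul (C.comul x)) := by
  have := LinearMap.congr_fun C.coassoc x
  simp only [LinearMap.comp_apply, LinearEquiv.coe_coe] at this
  rw [this]

/-- `a ⊗ (b ⊗ c) ↦ f a * g (b ⊗ c)`. -/
noncomputable def mul2 {N P : Type*} [AddCommGroup N] [Module k N] [AddCommGroup P] [Module k P]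
    (f : N →ₗ[k] H) (g : P →ₗ[k] H) : N ⊗[k] P →ₗ[k] H :=
  C.mul ∘ₗ TensorProduct.map f g

@[simp] theorem mul2_tmul {N P : Type*} [AddCommGroup N] [Module k N] [AddCommGroup P]
    [Module k P] (f : N →ₗ[k] H) (g : P →ₗ[k] H) (a : N) (b : P) :
    C.mul2 f g (a ⊗ₜ[k] b) = C.mul (f a ⊗ₜ[k] g b) := rfl

theorem counit_left_apply {N : Type*} [AddCommGroup N] [Module k N] (f : H →ₗ[k] N) (x : H) :
    TensorProduct.lift (LinearMap.lsmul k N ∘ₗ C.counit) 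
      (TensorProduct.map LinearMap.id f (C.comul x)) = f x := by
  conv_rhs => rw [← C.counit_left x]
  generalize C.comul x = t
  induction t with
  | zero => simp
  | add x y hx hy => simp only [map_add, hx, hy]
  | tmul a b => simp

theorem counit_right_apply {N : Type*} [AddCommGroup N] [Module k N] (f : H →ₗ[k] N) (x : H) :
    TensorProduct.lift (LinearMap.lsmul k N ∘ₗ C.counit).flip 
      (TensorProduct.map f LinearMap.id (C.comul x)) = f x := by
  conv_rhs => rw [← C.counit_right x]
  generalize C.comul x = t
  induction t with
  | zero => simp
  | add x y hx hy => simp only [map_add, hx, hy]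
  | tmul a b => simp

/-- `A (a ⊗ b) y = φ(|b|,|y|) S(a y) b`. -/
noncomputable def auxA : (H ⊗[k] H) ⊗[k] H →ₗ[k] H :=
  C.mul2 (C.antipode ∘ₗ C.mul) LinearMap.id ∘ₗ (TensorProduct.assoc k H H H).symm.toLinearMap ∘ₗ
    TensorProduct.map LinearMap.id C.braid ∘ₗ (TensorProduct.assoc k H H H).toLinearMap

/-- `F (c ⊗ (d ⊗ e)) = A t c * (d * S e)`. -/
noncomputable def auxF (t : H ⊗[k] H) : H ⊗[k] (H ⊗[k] H) →ₗ[k] H :=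
  C.mul2 (C.auxA ∘ₗ TensorProduct.mk k _ _ t) (C.mul2 LinearMap.id C.antipode)

theorem auxB (t s : H ⊗[k] H) :
    C.mul (TensorProduct.map C.antipode LinearMap.id
      (TensorProduct.map C.mul C.mul (midMap k C.braid (t ⊗ₜ[k] s)))) =
    C.mul2 (C.auxA ∘ₗ TensorProduct.mk k _ _ t) LinearMap.id s := by
  induction s with
  | zero => simp
  | add x y hx hy => simp only [TensorProduct.tmul_add, map_add, hx, hy]
  | tmul c d =>
    rw [mul2_tmul]
    simp only [LinearMap.comp_apply, TensorProduct.mk_apply, LinearMap.id_apply]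
    induction t with
    | zero => simp
    | add x y hx hy => simp only [TensorProduct.add_tmul, map_add, hx, hy]
    | tmul a b =>
      simp only [midMap, auxA, LinearMap.comp_apply, LinearEquiv.coe_coe, TensorProduct.assoc_tmul,
        TensorProduct.map_tmul, TensorProduct.assoc_symm_tmul, LinearMap.id_apply]
      generalize C.braid (b ⊗ₜ[k] c) = w
      induction w with
      | zero => simp
      | add x y hx hy =>
        simp only [TensorProduct.add_tmul, TensorProduct.tmul_add, map_add, hx, hy]
      | tmul p q => simp [C.mul_assoc']

theorem stepA (x y : H) : C.auxA (C.comul x ⊗ₜ[k] y) = C.counit x • C.antipode y := by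
  have h := C.coassoc_apply (C.auxF (C.comul x)) y
  have h1 : ∀ t : H ⊗[k] H, C.auxF (C.comul x) (TensorProduct.assoc k H H H
      (TensorProduct.map C.comul LinearMap.id t)) =
      TensorProduct.lift (LinearMap.lsmul k H ∘ₗ C.counit)
        (TensorProduct.map LinearMap.id (C.counit x • C.antipode) t) := by
    intro t
    induction t with
    | zero => simp
    | add x y hx hy => simp only [map_add, hx, hy]
    | tmul u v =>
      have h2 := C.antipode_left (C.mul (x ⊗ₜ[k] u))
      have h3 := LinearMap.congr_fun C.comul_mul (x ⊗ₜ[k] u)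
      simp only [LinearMap.comp_apply, TensorProduct.map_tmul] at h3
      rw [h3, auxB, C.counit_mul] at h2
      have h4 : ∀ s : H ⊗[k] H, C.auxF (C.comul x) (TensorProduct.assoc k H H H (s ⊗ₜ[k] v)) =
        C.mul (C.mul2 (C.auxA ∘ₗ TensorProduct.mk k _ _ (C.comul x)) LinearMap.id s ⊗ₜ[k]
          C.antipode v) := by
        intro s
        induction s with
        | zero => simp
        | add x y hx hy => simp only [TensorProduct.add_tmul, map_add, hx, hy]
        | tmul c d => simp [auxF, C.mul_assoc']
      rw [TensorProduct.map_tmul, LinearMap.id_apply, h4, h2]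
      simp [← TensorProduct.smul_tmul', C.one_mul', smul_smul, mul_comm]
  have h5 : ∀ t : H ⊗[k] H, C.auxF (C.comul x) (TensorProduct.map LinearMap.id C.comul t) =
      TensorProduct.lift (LinearMap.lsmul k H ∘ₗ C.counit).flip
        (TensorProduct.map (C.auxA ∘ₗ TensorProduct.mk k _ _ (C.comul x)) LinearMap.id t) := by
    intro t
    induction t with
    | zero => simp
    | add x y hx hy => simp only [map_add, hx, hy]
    | tmul u v =>
      have h2 := C.antipode_right v
      simp only [auxF, TensorProduct.map_tmul, mul2_tmul]
      rw [mul2, LinearMap.comp_apply (f := C.mul), h2]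
      simp [C.mul_one']
  rw [h1, h5, counit_left_apply, counit_right_apply] at h
  simpa using h.symm

/-- The antipode is a color anti-homomorphism. -/
theorem antipode_mul (h : G) (y : H) (σ : H →ₗ[k] H)
    (hb : ∀ x, C.braid (x ⊗ₜ[k] y) = y ⊗ₜ[k] σ x)
    (hm : ∀ a b, σ (C.mul (a ⊗ₜ[k] b)) = C.mul (σ a ⊗ₜ[k] σ b))
    (hS : ∀ a, σ (C.antipode a) = C.antipode (σ a)) (h1 : σ C.one = C.one) (x : H) :
    C.antipode (C.mul (x ⊗ₜ[k] y)) = C.mul (C.antipode y ⊗ₜ[k] C.antipode (σ x)) := by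
  let R : H →ₗ[k] H := C.antipode ∘ₗ C.mul ∘ₗ (TensorProduct.mk k H H).flip y
  have hA : ∀ t : H ⊗[k] H, C.auxA (t ⊗ₜ[k] y) = C.mul2 R σ t := by
    intro t
    induction t with
    | zero => simp
    | add x y hx hy => simp only [TensorProduct.add_tmul, map_add, hx, hy]
    | tmul a b => simp [auxA, hb, R]
  have h := C.coassoc_apply (C.mul2 R (C.mul2 σ (σ ∘ₗ C.antipode))) x
  have e1 : ∀ t : H ⊗[k] H, C.mul2 R (C.mul2 σ (σ ∘ₗ C.antipode)) (TensorProduct.assoc k H H H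
      (TensorProduct.map C.comul LinearMap.id t)) =
      TensorProduct.lift (LinearMap.lsmul k H ∘ₗ C.counit)
        (TensorProduct.map LinearMap.id
          (C.mul ∘ₗ TensorProduct.mk k H H (C.antipode y) ∘ₗ C.antipode ∘ₗ σ) t) := by
    intro t
    induction t with
    | zero => simp
    | add x y hx hy => simp only [map_add, hx, hy]
    | tmul u v =>
      have h4 : ∀ s : H ⊗[k] H, C.mul2 R (C.mul2 σ (σ ∘ₗ C.antipode))
          (TensorProduct.assoc k H H H (s ⊗ₜ[k] v)) =
          C.mul (C.mul2 R σ s ⊗ₜ[k] C.antipode (σ v)) := by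
        intro s
        induction s with
        | zero => simp
        | add x y hx hy => simp only [TensorProduct.add_tmul, map_add, hx, hy]
        | tmul c d => simp [C.mul_assoc', hS]
      rw [TensorProduct.map_tmul, LinearMap.id_apply, h4, ← hA, stepA]
      simp [← TensorProduct.smul_tmul']
  have e2 : ∀ t : H ⊗[k] H, C.mul2 R (C.mul2 σ (σ ∘ₗ C.antipode))
      (TensorProduct.map LinearMap.id C.comul t) =
      TensorProduct.lift (LinearMap.lsmul k H ∘ₗ C.counit).flip
        (TensorProduct.map R LinearMap.id t) := by
    intro t
    induction t with
    | zero => simp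
    | add x y hx hy => simp only [map_add, hx, hy]
    | tmul u v =>
      have h4 : ∀ s : H ⊗[k] H, C.mul2 σ (σ ∘ₗ C.antipode) s =
          σ (C.mul (TensorProduct.map LinearMap.id C.antipode s)) := by
        intro s
        induction s with
        | zero => simp
        | add x y hx hy => simp only [map_add, hx, hy]
        | tmul c d => simp [hm]
      rw [TensorProduct.map_tmul, mul2_tmul, h4, C.antipode_right]
      simp [h1, C.mul_one']
  rw [e1, e2, counit_left_apply, counit_right_apply] at h
  simpa [R] using h.symm

theorem mul_mem_prodSpan {V W : Submodule k H} {x y : H} (hx : x ∈ V) (hy : y ∈ W) :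
    C.mul (x ⊗ₜ[k] y) ∈ C.prodSpan V W := Submodule.subset_span ⟨x, hx, y, hy, rfl⟩

theorem sigma_mem {V : Submodule k H} (hV : C.IsCHSub V) (h : G) (σ : H →ₗ[k] H)
    (hσ : ∀ g, ∀ x ∈ C.grade g, σ x = C.φ g h • x) (x : H) (hx : x ∈ V) : σ x ∈ V := by
  have : Submodule.span k {y : H | y ∈ V ∧ ∃ g : G, y ∈ C.grade g} ≤ V.comap σ := by
    rw [Submodule.span_le]
    rintro y ⟨hy, g, hg⟩
    simp only [SetLike.mem_coe, Submodule.mem_comap, hσ g y hg]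
    exact V.smul_mem _ hy
  exact this (hV.graded x hx)

theorem range_induction {V W : Submodule k H} {N : Type*} [AddCommGroup N] [Module k N]
    (f : H ⊗[k] H →ₗ[k] N) (P : Submodule k N)
    (h : ∀ a ∈ V, ∀ b ∈ W, f (a ⊗ₜ[k] b) ∈ P) (t : H ⊗[k] H)
    (ht : t ∈ LinearMap.range (TensorProduct.map V.subtype W.subtype)) : f t ∈ P := by
  obtain ⟨t, rfl⟩ := ht
  induction t with
  | zero => simp
  | add x y hx hy => rw [map_add, map_add]; exact P.add_mem hx hy
  | tmul a b => exact h _ a.2 _ b.2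

theorem tmul_mem_range {V W : Submodule k H} {a b : H} (ha : a ∈ V) (hb : b ∈ W) :
    a ⊗ₜ[k] b ∈ LinearMap.range (TensorProduct.map V.subtype W.subtype) :=
  ⟨⟨a, ha⟩ ⊗ₜ ⟨b, hb⟩, rfl⟩

theorem mul_swap_mem {M K : Submodule k H} (hM : C.IsCHSub M) (hK : C.IsCHSub K)
    (hKn : C.IsNormal K) (m : H) (hm : m ∈ M) (x : H) (hx : x ∈ K) :
    C.mul (m ⊗ₜ[k] x) ∈ C.prodSpan K M := by
  suffices Submodule.span k {y : H | y ∈ K ∧ ∃ g : G, y ∈ C.grade g} ≤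
      (C.prodSpan K M).comap (C.mul ∘ₗ TensorProduct.mk k H H m) from this (hK.graded x hx)
  rw [Submodule.span_le]
  rintro y ⟨hy, h, hyh⟩
  simp only [SetLike.mem_coe, Submodule.mem_comap, LinearMap.comp_apply, TensorProduct.mk_apply]
  by_cases hy0 : y = 0
  · simp [hy0]
  obtain ⟨σ, hb, hmul, hS, h1, hσ⟩ := C.exists_sigma h y hyh hy0
  let L : H →ₗ[k] H := C.mul ∘ₗ (TensorProduct.mk k H H).flip y
  have hadj : ∀ a, C.adj (a ⊗ₜ[k] y) = C.mul2 L (C.antipode ∘ₗ σ) (C.comul a) := by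
    intro a
    simp only [adj, LinearMap.comp_apply, TensorProduct.map_tmul, LinearMap.id_apply]
    generalize C.comul a = t
    induction t with
    | zero => simp
    | add x y hx hy => simp only [TensorProduct.add_tmul, map_add, hx, hy]
    | tmul a b => simp [hb, L, C.mul_assoc']
  have hco := C.coassoc_apply (C.mul2 L (C.mul2 (C.antipode ∘ₗ σ) σ)) m
  have e1 : ∀ t : H ⊗[k] H, C.mul2 L (C.mul2 (C.antipode ∘ₗ σ) σ) (TensorProduct.assoc k H H H
      (TensorProduct.map C.comul LinearMap.id t)) =
      C.mul2 (C.adj ∘ₗ (TensorProduct.mk k H H).flip y) σ t := by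
    intro t
    induction t with
    | zero => simp
    | add x y hx hy => simp only [map_add, hx, hy]
    | tmul u v =>
      have h4 : ∀ s : H ⊗[k] H, C.mul2 L (C.mul2 (C.antipode ∘ₗ σ) σ)
          (TensorProduct.assoc k H H H (s ⊗ₜ[k] v)) =
          C.mul (C.mul2 L (C.antipode ∘ₗ σ) s ⊗ₜ[k] σ v) := by
        intro s
        induction s with
        | zero => simp
        | add x y hx hy => simp only [TensorProduct.add_tmul, map_add, hx, hy]
        | tmul c d => simp [C.mul_assoc']
      rw [TensorProduct.map_tmul, LinearMap.id_apply, h4, ← hadj]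
      simp
  have e2 : ∀ t : H ⊗[k] H, C.mul2 L (C.mul2 (C.antipode ∘ₗ σ) σ)
      (TensorProduct.map LinearMap.id C.comul t) =
      TensorProduct.lift (LinearMap.lsmul k H ∘ₗ C.counit).flip
        (TensorProduct.map L LinearMap.id t) := by
    intro t
    induction t with
    | zero => simp
    | add x y hx hy => simp only [map_add, hx, hy]
    | tmul u v =>
      have h4 : ∀ s : H ⊗[k] H, C.mul2 (C.antipode ∘ₗ σ) σ s =
          σ (C.mul (TensorProduct.map C.antipode LinearMap.id s)) := by
        intro s
        induction s with
        | zero => simp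
        | add x y hx hy => simp only [map_add, hx, hy]
        | tmul c d => simp [hmul, hS]
      rw [TensorProduct.map_tmul, mul2_tmul, h4, C.antipode_left]
      simp [h1, C.mul_one']
  rw [e1, e2, counit_right_apply] at hco
  change L m ∈ _
  rw [← hco]
  refine range_induction (V := M) (W := M) _ _ ?_ _ (hM.comul_mem m hm)
  intro a _ b hb'
  exact C.mul_mem_prodSpan (hKn a y hy) (C.sigma_mem hM h σ hσ b hb')

theorem braid_mem {V W : Submodule k H} (hV : C.IsCHSub V) (hW : C.IsCHSub W)
    (a : H) (ha : a ∈ V) (b : H) (hb : b ∈ W) :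
    C.braid (a ⊗ₜ[k] b) ∈ LinearMap.range (TensorProduct.map W.subtype V.subtype) := by
  suffices Submodule.span k {y : H | y ∈ W ∧ ∃ g : G, y ∈ C.grade g} ≤
      (LinearMap.range (TensorProduct.map W.subtype V.subtype)).comap
        (C.braid ∘ₗ TensorProduct.mk k H H a) from this (hW.graded b hb)
  rw [Submodule.span_le]
  rintro y ⟨hy, h, hyh⟩
  simp only [SetLike.mem_coe, Submodule.mem_comap, LinearMap.comp_apply, TensorProduct.mk_apply]
  by_cases hy0 : y = 0
  · simp [hy0]
  obtain ⟨σ, hb, -, -, -, hσ⟩ := C.exists_sigma h y hyh hy0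
  rw [hb]
  exact tmul_mem_range hy (C.sigma_mem hV h σ hσ a ha)

theorem prodSpan_le {V W P : Submodule k H} (h : ∀ x ∈ V, ∀ y ∈ W, C.mul (x ⊗ₜ[k] y) ∈ P) :
    C.prodSpan V W ≤ P := by
  rw [prodSpan, Submodule.span_le]
  rintro _ ⟨x, hx, y, hy, rfl⟩
  exact h x hx y hy

theorem prodSpan_isCHSub {M K : Submodule k H} (hM : C.IsCHSub M) (hK : C.IsCHSub K)
    (hKn : C.IsNormal K) : C.IsCHSub (C.prodSpan K M) where
  one_mem := by
    have := C.mul_mem_prodSpan hK.one_mem hM.one_mem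
    rwa [C.one_mul'] at this
  mul_mem := by
    intro x hx y hy
    have h1 : ∀ a ∈ K, ∀ z ∈ C.prodSpan K M, C.mul (a ⊗ₜ[k] z) ∈ C.prodSpan K M := by
      intro a ha z hz
      refine (C.prodSpan_le (P := (C.prodSpan K M).comap (C.mul ∘ₗ TensorProduct.mk k H H a)) ?_) hz
      intro u hu v hv
      simp only [Submodule.mem_comap, LinearMap.comp_apply, TensorProduct.mk_apply]
      rw [← C.mul_assoc']
      exact C.mul_mem_prodSpan (hK.mul_mem _ ha _ hu) hv
    have h2 : ∀ z ∈ C.prodSpan K M, ∀ b ∈ M, C.mul (z ⊗ₜ[k] b) ∈ C.prodSpan K M := by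
      intro z hz b hb
      refine (C.prodSpan_le
        (P := (C.prodSpan K M).comap (C.mul ∘ₗ (TensorProduct.mk k H H).flip b)) ?_) hz
      intro u hu v hv
      simp only [Submodule.mem_comap, LinearMap.comp_apply, TensorProduct.mk_apply,
        LinearMap.flip_apply]
      rw [C.mul_assoc']
      exact C.mul_mem_prodSpan hu (hM.mul_mem _ hv _ hb)
    refine (C.prodSpan_le
        (P := (C.prodSpan K M).comap (C.mul ∘ₗ (TensorProduct.mk k H H).flip y)) ?_) hx
    intro a ha b hb
    refine (C.prodSpan_le (P := (C.prodSpan K M).comap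
      (C.mul ∘ₗ TensorProduct.mk k H H (C.mul (a ⊗ₜ[k] b)))) ?_) hy
    intro c hc d hd
    simp only [Submodule.mem_comap, LinearMap.comp_apply, TensorProduct.mk_apply]
    rw [C.mul_assoc', ← C.mul_assoc' b]
    exact h1 a ha _ (h2 _ (C.mul_swap_mem hM hK hKn b hb c hc) d hd)
  comul_mem := by
    intro x hx
    refine (C.prodSpan_le (P := (LinearMap.range (TensorProduct.map (C.prodSpan K M).subtype
      (C.prodSpan K M).subtype)).comap C.comul) ?_) hx
    intro a ha b hb
    have h3 := LinearMap.congr_fun C.comul_mul (a ⊗ₜ[k] b)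
    simp only [LinearMap.comp_apply, TensorProduct.map_tmul] at h3
    rw [Submodule.mem_comap, h3]
    refine range_induction (V := K) (W := K) (TensorProduct.map C.mul C.mul ∘ₗ midMap k C.braid ∘ₗ
      (TensorProduct.mk k _ _).flip (C.comul b)) _ ?_ _ (hK.comul_mem a ha)
    intro p hp q hq
    refine range_induction (V := M) (W := M) (TensorProduct.map C.mul C.mul ∘ₗ midMap k C.braid ∘ₗ
      TensorProduct.mk k _ _ (p ⊗ₜ[k] q)) _ ?_ _ (hM.comul_mem b hb)
    intro r hr s hs
    simp only [midMap, LinearMap.comp_apply, LinearEquiv.coe_coe, TensorProduct.assoc_tmul,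
        TensorProduct.map_tmul, TensorProduct.assoc_symm_tmul, LinearMap.id_apply,
        TensorProduct.mk_apply]
    refine range_induction (V := M) (W := K) (TensorProduct.map C.mul C.mul ∘ₗ
      (TensorProduct.assoc k H H (H ⊗[k] H)).symm.toLinearMap ∘ₗ TensorProduct.mk k _ _ p ∘ₗ
      (TensorProduct.assoc k H H H).toLinearMap ∘ₗ (TensorProduct.mk k _ _).flip s) _ ?_ _
      (C.braid_mem hK hM q hq r hr)
    intro u hu v hv
    exact tmul_mem_range (C.mul_mem_prodSpan hp hu) (C.mul_mem_prodSpan hv hs)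
  antipode_mem := by
    intro x hx
    refine (C.prodSpan_le (P := (C.prodSpan K M).comap C.antipode) ?_) hx
    intro a ha b hb
    suffices Submodule.span k {y : H | y ∈ M ∧ ∃ g : G, y ∈ C.grade g} ≤
      (C.prodSpan K M).comap (C.antipode ∘ₗ C.mul ∘ₗ TensorProduct.mk k H H a) from
        this (hM.graded b hb)
    rw [Submodule.span_le]
    rintro y ⟨hy, h, hyh⟩
    simp only [SetLike.mem_coe, Submodule.mem_comap, LinearMap.comp_apply, TensorProduct.mk_apply]
    by_cases hy0 : y = 0
    · simp [hy0]
    obtain ⟨σ, hb, hmul, hS, h1, hσ⟩ := C.exists_sigma h y hyh hy0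
    rw [C.antipode_mul h y σ hb hmul hS h1]
    exact C.mul_swap_mem hM hK hKn _ (hM.antipode_mem _ hy) _
      (hK.antipode_mem _ (C.sigma_mem hK h σ hσ a ha))
  graded := by
    intro x hx
    refine (C.prodSpan_le ?_) hx
    intro a ha b hb
    suffices Submodule.span k {y : H | y ∈ K ∧ ∃ g : G, y ∈ C.grade g} ≤
      (Submodule.span k {y : H | y ∈ C.prodSpan K M ∧ ∃ g : G, y ∈ C.grade g}).comap
        (C.mul ∘ₗ (TensorProduct.mk k H H).flip b) from this (hK.graded a ha)
    rw [Submodule.span_le]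
    rintro y ⟨hy, g, hg⟩
    suffices Submodule.span k {y : H | y ∈ M ∧ ∃ g : G, y ∈ C.grade g} ≤
      (Submodule.span k {y : H | y ∈ C.prodSpan K M ∧ ∃ g : G, y ∈ C.grade g}).comap
        (C.mul ∘ₗ TensorProduct.mk k H H y) from this (hM.graded b hb)
    rw [Submodule.span_le]
    rintro z ⟨hz, g', hg'⟩
    exact Submodule.subset_span ⟨C.mul_mem_prodSpan hy hz, g * g', C.mul_mem g g' y z hg hg'⟩

end Helpers

end ColorHopfAlg

section Statements

variable {H : Type*} [AddCommGroup H] [Module k H]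

/-- if `K` is normal then `KM` is a color Hopf subalgebra of `A` and is
the supremum of `K` and `M` among color Hopf subalgebras of `A`. -/
theorem KM_is_sup (C : ColorHopfAlg k G H)
    (M K : Submodule k H) (hM : C.IsCHSub M) (hK : C.IsCHSub K)
    (hKn : C.IsNormal K) :
    C.IsCHSub (C.prodSpan K M) ∧
    K ≤ C.prodSpan K M ∧ M ≤ C.prodSpan K M ∧
    (∀ L : Submodule k H, C.IsCHSub L → K ≤ L → M ≤ L → C.prodSpan K M ≤ L) := by
  refine ⟨C.prodSpan_isCHSub hM hK hKn, ?_, ?_, ?_⟩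
  · intro x hx
    have := C.mul_mem_prodSpan hx hM.one_mem
    rwa [C.mul_one'] at this
  · intro x hx
    have := C.mul_mem_prodSpan hK.one_mem hx
    rwa [C.one_mul'] at this
  · intro L hL hKL hML
    exact C.prodSpan_le fun x hx y hy => hL.mul_mem x (hKL hx) y (hML hy)

end Statements

end ColorHopfPaper
end

section
/- Let ℋ be a simplicial cocommutative color Hopf algebra with Moore complex of length one. Then the adjoint action of the Hopf kernel M(ℋ)₁ = Hker(d¹₀) on itself factors through ∂₁ = d¹₁ restricted to M(ℋ)₁: for all homogeneous x, y ∈ M(ℋ)₁, φ(|x₂|,|y|) x₁ y S(x₂) = ∂₁(x) · y, where a · y := φ(|a₂|,|y|) s¹₀(a₁) y s¹₀(S(a₂)) for a ∈ H₀. Consequently (H₀, M(ℋ)₁, ∂₁) is a color Hopf crossed module. -/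
open TensorProduct

namespace ColorHopfPaper

variable (k : Type*) [Field k] (G : Type*) [CommGroup G]

variable (Mo : ℕ → Type*) [∀ n, AddCommGroup (Mo n)] [∀ n, Module k (Mo n)]

/-- A simplicial cocommutative color Hopf algebra (faces `d n i : Mo (n+1) → Mo n`
are the `dⁿ⁺¹ᵢ` of the paper, degeneracies `s n i : Mo n → Mo (n+1)` are the
`sⁿ⁺¹ᵢ`; indices beyond the simplicial range are junk). -/
structure SimpColorHopf where
  C : ∀ n : ℕ, ColorHopfAlg k G (Mo n)
  φ_const : ∀ n : ℕ, (C (n + 1)).φ = (C n).φ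
  d : ∀ n : ℕ, ℕ → (Mo (n + 1) →ₗ[k] Mo n)
  s : ∀ n : ℕ, ℕ → (Mo n →ₗ[k] Mo (n + 1))
  d_hom : ∀ n i, i ≤ n + 1 → IsColorHom k G (C (n + 1)) (C n) (d n i)
  s_hom : ∀ n i, i ≤ n → IsColorHom k G (C n) (C (n + 1)) (s n i)
  dd : ∀ n i j, i < j → j ≤ n + 2 →
    (d n i) ∘ₗ (d (n + 1) j) = (d n (j - 1)) ∘ₗ (d (n + 1) i)
  ss : ∀ n i j, i ≤ j → j ≤ n →
    (s (n + 1) i) ∘ₗ (s n j) = (s (n + 1) (j + 1)) ∘ₗ (s n i)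
  ds_lt : ∀ n i j, i < j → j ≤ n + 1 →
    (d (n + 1) i) ∘ₗ (s (n + 1) j) = (s n (j - 1)) ∘ₗ (d n i)
  ds_eq₁ : ∀ n j, j ≤ n → (d n j) ∘ₗ (s n j) = LinearMap.id
  ds_eq₂ : ∀ n j, j ≤ n → (d n (j + 1)) ∘ₗ (s n j) = LinearMap.id
  ds_gt : ∀ n i j, j + 1 < i → i ≤ n + 2 →
    (d (n + 1) i) ∘ₗ (s (n + 1) j) = (s n j) ∘ₗ (d n (i - 1))

/-- The `(n+1)`-st term `M(ℋ)ₙ₊₁ = ⋂_{i=0}^{n} Hker(dⁿ⁺¹ᵢ)` of the Moore complex. -/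
noncomputable def SimpColorHopf.moore {k : Type*} [Field k] {G : Type*} [CommGroup G]
    {Mo : ℕ → Type*} [∀ n, AddCommGroup (Mo n)] [∀ n, Module k (Mo n)]
    (S : SimpColorHopf k G Mo) (n : ℕ) :
    Submodule k (Mo (n + 1)) :=
  ⨅ i ∈ Finset.range (n + 1), (S.C (n + 1)).hkerOf (S.C n) (S.d n i)

section Helpers

variable {k : Type*} [Field k] {G : Type*} [CommGroup G]

/-- Linear maps on a tensor product of color Hopf algebras agree if they agree on homogeneous tensors. -/
theorem ext_homog {A B V : Type*} [AddCommGroup A] [Module k A] [AddCommGroup B] [Module k B]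
    [AddCommGroup V] [Module k V] (CA : ColorHopfAlg k G A) (CB : ColorHopfAlg k G B)
    {f g : A ⊗[k] B →ₗ[k] V}
    (h : ∀ (i j : G) (x : A) (y : B), x ∈ CA.grade i → y ∈ CB.grade j →
      f (x ⊗ₜ[k] y) = g (x ⊗ₜ[k] y)) : f = g := by
  apply TensorProduct.ext'
  intro x y
  have hx : x ∈ ⨆ i, CA.grade i := by rw [CA.grade_top]; trivial
  have hy : y ∈ ⨆ i, CB.grade i := by rw [CB.grade_top]; trivial
  induction hx using Submodule.iSup_induction' with
  | mem i x hx =>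
    induction hy using Submodule.iSup_induction' with
    | mem j y hy => exact h i j x y hx hy
    | zero => simp
    | add y y' _ _ h1 h2 => simp only [TensorProduct.tmul_add, map_add, h1, h2]
  | zero => simp
  | add x x' _ _ h1 h2 => simp only [TensorProduct.add_tmul, map_add, h1, h2]

/-- Induction to homogeneous elements for an additive-closed predicate. -/
theorem homog_ind {A : Type*} [AddCommGroup A] [Module k A] (CA : ColorHopfAlg k G A)
    {P : A → Prop} (h : ∀ i, ∀ x ∈ CA.grade i, P x) (h0 : P 0)
    (ha : ∀ x y, P x → P y → P (x + y)) (x : A) : P x := by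
  have hx : x ∈ ⨆ i, CA.grade i := by rw [CA.grade_top]; trivial
  induction hx using Submodule.iSup_induction' with
  | mem i x hx => exact h i x hx
  | zero => exact h0
  | add x x' _ _ h1 h2 => exact ha _ _ h1 h2

variable {D H T : Type*} [AddCommGroup D] [Module k D] [AddCommGroup H] [Module k H]
  [AddCommGroup T] [Module k T]

/-- Convolution product. -/
noncomputable def conv (Δ : D →ₗ[k] D ⊗[k] D) (m : T ⊗[k] T →ₗ[k] T) (α β : D →ₗ[k] T) :
    D →ₗ[k] T := m ∘ₗ TensorProduct.map α β ∘ₗ Δ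

theorem conv_assoc (Δ : D →ₗ[k] D ⊗[k] D) (m : T ⊗[k] T →ₗ[k] T)
    (hΔ : (TensorProduct.assoc k D D D).toLinearMap ∘ₗ
      (TensorProduct.map Δ LinearMap.id) ∘ₗ Δ = (TensorProduct.map LinearMap.id Δ) ∘ₗ Δ)
    (hm : ∀ x y z, m (m (x ⊗ₜ[k] y) ⊗ₜ[k] z) = m (x ⊗ₜ[k] m (y ⊗ₜ[k] z)))
    (α β γ : D →ₗ[k] T) :
    conv Δ m (conv Δ m α β) γ = conv Δ m α (conv Δ m β γ) := by
  have e1 : conv Δ m α (conv Δ m β γ) = (m ∘ₗ TensorProduct.map LinearMap.id m ∘ₗ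
      TensorProduct.map α (TensorProduct.map β γ)) ∘ₗ (TensorProduct.map LinearMap.id Δ) ∘ₗ Δ := by
    simp only [conv, ← LinearMap.comp_assoc]
    congr 1
    ext; simp
  have e2 : conv Δ m (conv Δ m α β) γ = (m ∘ₗ TensorProduct.map LinearMap.id m ∘ₗ
      TensorProduct.map α (TensorProduct.map β γ)) ∘ₗ ((TensorProduct.assoc k D D D).toLinearMap ∘ₗ
      (TensorProduct.map Δ LinearMap.id) ∘ₗ Δ) := by
    have : m ∘ₗ TensorProduct.map m LinearMap.id = m ∘ₗ TensorProduct.map LinearMap.id m ∘ₗ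
        (TensorProduct.assoc k T T T).toLinearMap := by
      ext; simp [hm]
    have h2 : m ∘ₗ TensorProduct.map (conv Δ m α β) γ = (m ∘ₗ TensorProduct.map m LinearMap.id) ∘ₗ
        (TensorProduct.map (TensorProduct.map α β) γ) ∘ₗ TensorProduct.map Δ LinearMap.id := by
      ext; simp [conv]
    have h3 : (TensorProduct.assoc k T T T).toLinearMap ∘ₗ
        (TensorProduct.map (TensorProduct.map α β) γ) =
        TensorProduct.map α (TensorProduct.map β γ) ∘ₗ
          (TensorProduct.assoc k D D D).toLinearMap := by
      ext; simp
    rw [conv, ← LinearMap.comp_assoc, h2, this]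
    simp only [LinearMap.comp_assoc]
    rw [← LinearMap.comp_assoc (TensorProduct.map Δ LinearMap.id ∘ₗ Δ), h3]
    simp only [LinearMap.comp_assoc]
  rw [e1, e2, hΔ]

/-- Unit of convolution. -/
noncomputable def cunit (ε : D →ₗ[k] k) (one : T) : D →ₗ[k] T := LinearMap.toSpanSingleton k T one ∘ₗ ε

theorem cunit_apply (ε : D →ₗ[k] k) (one : T) (x : D) : cunit ε one x = ε x • one := by
  simp [cunit]

theorem cunit_conv (CD : ColorHopfAlg k G D) (m : T ⊗[k] T →ₗ[k] T) (one : T)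
    (hm : ∀ x, m (one ⊗ₜ[k] x) = x) (α : D →ₗ[k] T) :
    conv CD.comul m (cunit CD.counit one) α = α := by
  have : m ∘ₗ TensorProduct.map (cunit CD.counit one) α =
      α ∘ₗ (TensorProduct.lid k D).toLinearMap ∘ₗ TensorProduct.map CD.counit LinearMap.id := by
    ext a b; simp [cunit_apply, ← TensorProduct.smul_tmul', hm]
  rw [conv, ← LinearMap.comp_assoc, this]
  ext x
  simp [CD.counit_left]

theorem conv_cunit (CD : ColorHopfAlg k G D) (m : T ⊗[k] T →ₗ[k] T) (one : T)
    (hm : ∀ x, m (x ⊗ₜ[k] one) = x) (α : D →ₗ[k] T) :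
    conv CD.comul m α (cunit CD.counit one) = α := by
  have : m ∘ₗ TensorProduct.map α (cunit CD.counit one) =
      α ∘ₗ (TensorProduct.rid k D).toLinearMap ∘ₗ TensorProduct.map LinearMap.id CD.counit := by
    ext a b; simp [cunit_apply, hm]
  rw [conv, ← LinearMap.comp_assoc, this]
  ext x
  simp [CD.counit_right]

/-- Type synonym for linear maps with convolution product. -/
def Cv (_ : ColorHopfAlg k G D) (_ : ColorHopfAlg k G T) := D →ₗ[k] T

noncomputable instance (CD : ColorHopfAlg k G D) (CT : ColorHopfAlg k G T) : Monoid (Cv CD CT) where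
  mul α β := conv CD.comul CT.mul α β
  one := cunit CD.counit CT.one
  mul_assoc α β γ := conv_assoc _ _ CD.coassoc CT.mul_assoc' α β γ
  one_mul α := cunit_conv CD _ _ CT.one_mul' α
  mul_one α := conv_cunit CD _ _ CT.mul_one' α

theorem Cv.mul_def {CD : ColorHopfAlg k G D} {CT : ColorHopfAlg k G T} (α β : Cv CD CT) :
    α * β = conv CD.comul CT.mul α β := rfl

theorem Cv.one_def {CD : ColorHopfAlg k G D} {CT : ColorHopfAlg k G T} :
    (1 : Cv CD CT) = cunit CD.counit CT.one := rfl

/-- compatibility of two maps with braiding -/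
def Kc (CD : ColorHopfAlg k G D) (CT : ColorHopfAlg k G T) (α β : D →ₗ[k] T) : Prop :=
  CT.braid ∘ₗ TensorProduct.map α β ∘ₗ CD.comul = TensorProduct.map β α ∘ₗ CD.comul

theorem braid_braid (C : ColorHopfAlg k G H) : C.braid ∘ₗ C.braid = LinearMap.id := by
  apply ext_homog C C
  intro i j x y hx hy
  simp [C.braid_apply i j x y hx hy, C.braid_apply j i y x hy hx, smul_smul, C.φ_skew]

theorem Kc.symm {CD : ColorHopfAlg k G D} {CT : ColorHopfAlg k G T} {α β : D →ₗ[k] T}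
    (h : Kc CD CT α β) : Kc CD CT β α := by
  unfold Kc at *
  rw [← h, ← LinearMap.comp_assoc, braid_braid, LinearMap.id_comp]

theorem φ_one_left (C : ColorHopfAlg k G H) (g : G) : C.φ 1 g = 1 := by
  have := C.φ_mul_left 1 1 g
  rw [mul_one] at this
  exact (mul_eq_left₀ (C.φ_ne 1 g)).1 this.symm

theorem φ_one_right (C : ColorHopfAlg k G H) (g : G) : C.φ g 1 = 1 := by
  have := C.φ_mul_right g 1 1
  rw [mul_one] at this
  exact (mul_eq_left₀ (C.φ_ne g 1)).1 this.symm

theorem braid_one_left (C : ColorHopfAlg k G H) (x : H) :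
    C.braid (C.one ⊗ₜ[k] x) = x ⊗ₜ[k] C.one := by
  induction x using homog_ind C with
  | h i x hx => rw [C.braid_apply 1 i _ _ C.one_mem hx, φ_one_left, one_smul]
  | h0 => simp
  | ha x y h1 h2 => simp only [TensorProduct.tmul_add, TensorProduct.add_tmul, map_add, h1, h2]

theorem braid_one_right (C : ColorHopfAlg k G H) (x : H) :
    C.braid (x ⊗ₜ[k] C.one) = C.one ⊗ₜ[k] x := by
  induction x using homog_ind C with
  | h i x hx => rw [C.braid_apply i 1 _ _ hx C.one_mem, φ_one_right, one_smul]
  | h0 => simp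
  | ha x y h1 h2 => simp only [TensorProduct.tmul_add, TensorProduct.add_tmul, map_add, h1, h2]

/-- naturality of the braiding for graded maps -/
theorem braid_nat {A B : Type*} [AddCommGroup A] [Module k A] [AddCommGroup B] [Module k B]
    (CA : ColorHopfAlg k G A) (CB : ColorHopfAlg k G B) (hφ : CA.φ = CB.φ) (f g : A →ₗ[k] B)
    (hf : ∀ i, ∀ x ∈ CA.grade i, f x ∈ CB.grade i) (hg : ∀ i, ∀ x ∈ CA.grade i, g x ∈ CB.grade i) :
    CB.braid ∘ₗ TensorProduct.map f g = TensorProduct.map g f ∘ₗ CA.braid := by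
  apply ext_homog CA CA
  intro i j x y hx hy
  simp [CA.braid_apply i j x y hx hy, CB.braid_apply i j _ _ (hf i x hx) (hg j y hy), hφ]

theorem Kc_of_graded {CD : ColorHopfAlg k G D} {CT : ColorHopfAlg k G T} (hφ : CD.φ = CT.φ)
    {α β : D →ₗ[k] T}
    (hf : ∀ i, ∀ x ∈ CD.grade i, α x ∈ CT.grade i) (hg : ∀ i, ∀ x ∈ CD.grade i, β x ∈ CT.grade i) :
    Kc CD CT α β := by
  unfold Kc
  rw [← LinearMap.comp_assoc, braid_nat CD CT hφ α β hf hg, LinearMap.comp_assoc, CD.cocomm]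

/-- braiding past a product -/
theorem braid_mul_left (C : ColorHopfAlg k G H) :
    C.braid ∘ₗ TensorProduct.map C.mul LinearMap.id =
    TensorProduct.map LinearMap.id C.mul ∘ₗ (TensorProduct.assoc k H H H).toLinearMap ∘ₗ
      TensorProduct.map C.braid LinearMap.id ∘ₗ (TensorProduct.assoc k H H H).symm.toLinearMap ∘ₗ
      TensorProduct.map LinearMap.id C.braid ∘ₗ (TensorProduct.assoc k H H H).toLinearMap := by
  apply TensorProduct.ext_threefold
  intro a b d
  induction a using homog_ind C with
  | h i a ha =>
    induction b using homog_ind C with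
    | h j b hb =>
      induction d using homog_ind C with
      | h l d hd =>
        simp [C.braid_apply _ _ _ _ (C.mul_mem i j a b ha hb) hd, C.braid_apply j l b d hb hd,
          C.braid_apply i l a d ha hd, TensorProduct.tmul_smul, ← TensorProduct.smul_tmul',
          C.φ_mul_left, smul_smul, mul_comm]
      | h0 => simp
      | ha x y h1 h2 => simp only [TensorProduct.tmul_add, map_add, h1, h2]
    | h0 => simp
    | ha x y h1 h2 => simp only [TensorProduct.tmul_add, TensorProduct.add_tmul, map_add, h1, h2]
  | h0 => simp
  | ha x y h1 h2 => simp only [TensorProduct.tmul_add, TensorProduct.add_tmul, map_add, h1, h2]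

end Helpers

section Helpers2

variable {k : Type*} [Field k] {G : Type*} [CommGroup G]
variable {D H T : Type*} [AddCommGroup D] [Module k D] [AddCommGroup H] [Module k H]
  [AddCommGroup T] [Module k T]

theorem coassoc_symm (CD : ColorHopfAlg k G D) :
    (TensorProduct.assoc k D D D).symm.toLinearMap ∘ₗ map LinearMap.id CD.comul ∘ₗ CD.comul =
      map CD.comul LinearMap.id ∘ₗ CD.comul := by
  rw [← CD.coassoc]
  ext x; simp

theorem assoc_nat {A A' B B' E E' : Type*} [AddCommGroup A] [Module k A] [AddCommGroup B]
    [Module k B] [AddCommGroup E] [Module k E] [AddCommGroup A'] [Module k A'] [AddCommGroup B']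
    [Module k B'] [AddCommGroup E'] [Module k E'] (f : A →ₗ[k] A') (g : B →ₗ[k] B')
    (h : E →ₗ[k] E') :
    (TensorProduct.assoc k A' B' E').toLinearMap ∘ₗ map (map f g) h =
      map f (map g h) ∘ₗ (TensorProduct.assoc k A B E).toLinearMap := by
  ext; simp

theorem assoc_symm_nat {A A' B B' E E' : Type*} [AddCommGroup A] [Module k A] [AddCommGroup B]
    [Module k B] [AddCommGroup E] [Module k E] [AddCommGroup A'] [Module k A'] [AddCommGroup B']
    [Module k B'] [AddCommGroup E'] [Module k E'] (f : A →ₗ[k] A') (g : B →ₗ[k] B')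
    (h : E →ₗ[k] E') :
    (TensorProduct.assoc k A' B' E').symm.toLinearMap ∘ₗ map f (map g h) =
      map (map f g) h ∘ₗ (TensorProduct.assoc k A B E).symm.toLinearMap := by
  ext; simp

/-- iterated comultiplication, mapped -/
theorem assoc_map3 (CD : ColorHopfAlg k G D) {A B E : Type*} [AddCommGroup A] [Module k A]
    [AddCommGroup B] [Module k B] [AddCommGroup E] [Module k E]
    (f : D →ₗ[k] A) (g : D →ₗ[k] B) (h : D →ₗ[k] E) :
    (TensorProduct.assoc k A B E).toLinearMap ∘ₗ map (map f g ∘ₗ CD.comul) h ∘ₗ CD.comul =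
      map f (map g h ∘ₗ CD.comul) ∘ₗ CD.comul := by
  have e1 : map (map f g ∘ₗ CD.comul) h = map (map f g) h ∘ₗ map CD.comul LinearMap.id := by
    rw [← map_comp, LinearMap.comp_id]
  have e2 : map f (map g h ∘ₗ CD.comul) = map f (map g h) ∘ₗ map LinearMap.id CD.comul := by
    rw [← map_comp, LinearMap.comp_id]
  rw [e1, e2, ← LinearMap.comp_assoc, ← LinearMap.comp_assoc, assoc_nat, LinearMap.comp_assoc,
    LinearMap.comp_assoc, LinearMap.comp_assoc, CD.coassoc]

theorem assoc_symm_map3 (CD : ColorHopfAlg k G D) {A B E : Type*} [AddCommGroup A] [Module k A]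
    [AddCommGroup B] [Module k B] [AddCommGroup E] [Module k E]
    (f : D →ₗ[k] A) (g : D →ₗ[k] B) (h : D →ₗ[k] E) :
    (TensorProduct.assoc k A B E).symm.toLinearMap ∘ₗ map f (map g h ∘ₗ CD.comul) ∘ₗ CD.comul =
      map (map f g ∘ₗ CD.comul) h ∘ₗ CD.comul := by
  rw [← assoc_map3]
  ext x; simp

theorem mm {A A' B B' E E' F : Type*} [AddCommGroup A] [Module k A] [AddCommGroup B]
    [Module k B] [AddCommGroup E] [Module k E] [AddCommGroup A'] [Module k A'] [AddCommGroup B']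
    [Module k B'] [AddCommGroup E'] [Module k E'] [AddCommGroup F] [Module k F]
    (f : A' →ₗ[k] E) (g : B' →ₗ[k] E') (a : A →ₗ[k] A') (b : B →ₗ[k] B') (w : F →ₗ[k] A ⊗[k] B) :
    map f g ∘ₗ map a b ∘ₗ w = map (f ∘ₗ a) (g ∘ₗ b) ∘ₗ w := by
  rw [← LinearMap.comp_assoc, ← map_comp]

theorem Kc_conv {CD : ColorHopfAlg k G D} {CT : ColorHopfAlg k G T} {α β γ : D →ₗ[k] T}
    (h1 : Kc CD CT α γ) (h2 : Kc CD CT β γ) : Kc CD CT (conv CD.comul CT.mul α β) γ := by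
  unfold Kc at *
  have e1 : map (conv CD.comul CT.mul α β) γ ∘ₗ CD.comul =
      map CT.mul LinearMap.id ∘ₗ map (map α β ∘ₗ CD.comul) γ ∘ₗ CD.comul := by
    rw [mm]; rfl
  have e2 : map γ (conv CD.comul CT.mul α β) ∘ₗ CD.comul =
      map LinearMap.id CT.mul ∘ₗ map γ (map α β ∘ₗ CD.comul) ∘ₗ CD.comul := by
    rw [mm]; rfl
  rw [e1, e2, ← LinearMap.comp_assoc, braid_mul_left]
  simp only [LinearMap.comp_assoc]
  rw [assoc_map3, mm, h2, LinearMap.id_comp, assoc_symm_map3, mm _ _ _ _ CD.comul, h1,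
    LinearMap.id_comp, assoc_map3]

theorem Kc_antipode {CD : ColorHopfAlg k G D} {CT : ColorHopfAlg k G T} {α γ : D →ₗ[k] T}
    (h1 : Kc CD CT α γ) : Kc CD CT (CT.antipode ∘ₗ α) γ := by
  unfold Kc at *
  have e1 : map (CT.antipode ∘ₗ α) γ ∘ₗ CD.comul =
      map CT.antipode LinearMap.id ∘ₗ map α γ ∘ₗ CD.comul := by
    rw [mm]; rfl
  have e2 : map γ (CT.antipode ∘ₗ α) ∘ₗ CD.comul =
      map LinearMap.id CT.antipode ∘ₗ map γ α ∘ₗ CD.comul := by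
    rw [mm]; rfl
  rw [e1, e2, ← h1, ← LinearMap.comp_assoc, braid_nat CT CT rfl _ _ CT.antipode_mem (fun _ _ h => h)]
  rfl

/-- multiplication of the braided tensor square -/
noncomputable def mul2 (C : ColorHopfAlg k G H) : (H ⊗[k] H) ⊗[k] (H ⊗[k] H) →ₗ[k] H ⊗[k] H :=
  map C.mul C.mul ∘ₗ midMap k C.braid

theorem comul_four (CD : ColorHopfAlg k G D) {A B E F : Type*} [AddCommGroup A] [Module k A]
    [AddCommGroup B] [Module k B] [AddCommGroup E] [Module k E] [AddCommGroup F] [Module k F]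
    (f : D →ₗ[k] A) (g : D →ₗ[k] B) (h : D →ₗ[k] E) (l : D →ₗ[k] F) :
    (TensorProduct.assoc k A B (E ⊗[k] F)).toLinearMap ∘ₗ
      map (map f g ∘ₗ CD.comul) (map h l ∘ₗ CD.comul) ∘ₗ CD.comul =
    map f (map g (map h l ∘ₗ CD.comul) ∘ₗ CD.comul) ∘ₗ CD.comul := by
  rw [assoc_map3]

theorem mul2_conv {CD : ColorHopfAlg k G D} {CT : ColorHopfAlg k G T} {α β : D →ₗ[k] T}
    (h : Kc CD CT α β) :
    mul2 CT ∘ₗ map (map α α ∘ₗ CD.comul) (map β β ∘ₗ CD.comul) ∘ₗ CD.comul =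
      map (conv CD.comul CT.mul α β) (conv CD.comul CT.mul α β) ∘ₗ CD.comul := by
  have e : map (conv CD.comul CT.mul α β) (conv CD.comul CT.mul α β) ∘ₗ CD.comul =
    map CT.mul CT.mul ∘ₗ map (map α β ∘ₗ CD.comul) (map α β ∘ₗ CD.comul) ∘ₗ CD.comul := by
    rw [mm]; rfl
  rw [e, mul2, midMap]
  simp only [LinearMap.comp_assoc]
  rw [assoc_map3, mm]
  simp only [LinearMap.comp_assoc]
  rw [assoc_symm_map3, mm _ _ _ _ CD.comul, h, LinearMap.id_comp, LinearMap.id_comp, assoc_map3,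
    assoc_symm_map3]

end Helpers2
section Helpers3

variable {k : Type*} [Field k] {G : Type*} [CommGroup G]
variable {D H T : Type*} [AddCommGroup D] [Module k D] [AddCommGroup H] [Module k H]
  [AddCommGroup T] [Module k T]

theorem homog_ind2 (C : ColorHopfAlg k G H)
    {P : H ⊗[k] H → Prop} (h : ∀ i j, ∀ x ∈ C.grade i, ∀ y ∈ C.grade j, P (x ⊗ₜ[k] y)) (h0 : P 0)
    (ha : ∀ x y, P x → P y → P (x + y)) (t : H ⊗[k] H) : P t := by
  induction t using TensorProduct.induction_on with
  | zero => exact h0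
  | add x y hx hy => exact ha x y hx hy
  | tmul x y =>
    induction x using homog_ind C with
    | h i x hx =>
      induction y using homog_ind C with
      | h j y hy => exact h i j x hx y hy
      | h0 => simpa using h0
      | ha y z h1 h2 => rw [TensorProduct.tmul_add]; exact ha _ _ h1 h2
    | h0 => simpa using h0
    | ha x z h1 h2 => rw [TensorProduct.add_tmul]; exact ha _ _ h1 h2

theorem mul2_apply (C : ColorHopfAlg k G H) {i j : G} (a b c d : H) (hb : b ∈ C.grade i)
    (hc : c ∈ C.grade j) : mul2 C ((a ⊗ₜ[k] b) ⊗ₜ[k] (c ⊗ₜ[k] d)) =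
      C.φ i j • (C.mul (a ⊗ₜ[k] c) ⊗ₜ[k] C.mul (b ⊗ₜ[k] d)) := by
  simp [mul2, midMap, C.braid_apply i j b c hb hc, TensorProduct.tmul_smul,
    ← TensorProduct.smul_tmul']

theorem mul2_assoc (C : ColorHopfAlg k G H) (x y z : H ⊗[k] H) :
    mul2 C (mul2 C (x ⊗ₜ[k] y) ⊗ₜ[k] z) = mul2 C (x ⊗ₜ[k] mul2 C (y ⊗ₜ[k] z)) := by
  induction x using homog_ind2 C with
  | h i j a ha b hb =>
    induction y using homog_ind2 C with
    | h i' j' a' ha' b' hb' =>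
      induction z using homog_ind2 C with
      | h i'' j'' a'' ha'' b'' hb'' =>
        rw [mul2_apply C a b a' b' hb ha', mul2_apply C a' b' a'' b'' hb' ha'',
          ← TensorProduct.smul_tmul', TensorProduct.tmul_smul, map_smul, map_smul,
          mul2_apply C _ _ _ _ (C.mul_mem _ _ _ _ hb hb') ha'',
          mul2_apply C _ _ _ _ hb (C.mul_mem _ _ _ _ ha' ha''), C.mul_assoc', C.mul_assoc',
          smul_smul, smul_smul, C.φ_mul_left, C.φ_mul_right]
        congr 1; ring
      | h0 => simp
      | ha x y h1 h2 => simp only [TensorProduct.tmul_add, map_add, h1, h2]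
    | h0 => simp
    | ha x y h1 h2 => simp only [TensorProduct.tmul_add, TensorProduct.add_tmul, map_add, h1, h2]
  | h0 => simp
  | ha x y h1 h2 => simp only [TensorProduct.add_tmul, map_add, h1, h2]

theorem mul2_one_left (C : ColorHopfAlg k G H) (x : H ⊗[k] H) :
    mul2 C ((C.one ⊗ₜ[k] C.one) ⊗ₜ[k] x) = x := by
  induction x using homog_ind2 C with
  | h i j a ha b hb =>
    rw [mul2_apply C _ _ _ _ C.one_mem ha, φ_one_left, one_smul, C.one_mul', C.one_mul']
  | h0 => simp
  | ha x y h1 h2 => simp only [TensorProduct.tmul_add, map_add, h1, h2]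

theorem mul2_one_right (C : ColorHopfAlg k G H) (x : H ⊗[k] H) :
    mul2 C (x ⊗ₜ[k] (C.one ⊗ₜ[k] C.one)) = x := by
  induction x using homog_ind2 C with
  | h i j a ha b hb =>
    rw [mul2_apply C _ _ _ _ hb C.one_mem, φ_one_right, one_smul, C.mul_one', C.mul_one']
  | h0 => simp
  | ha x y h1 h2 => simp only [TensorProduct.add_tmul, map_add, h1, h2]

theorem comul_mul2 (C : ColorHopfAlg k G H) :
    C.comul ∘ₗ C.mul = mul2 C ∘ₗ map C.comul C.comul := by
  rw [C.comul_mul, mul2]; rfl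

/-- coalgebra maps -/
structure Coalg (CD : ColorHopfAlg k G D) (CT : ColorHopfAlg k G T) (α : D →ₗ[k] T) : Prop where
  comul : CT.comul ∘ₗ α = map α α ∘ₗ CD.comul
  counit : CT.counit ∘ₗ α = CD.counit

theorem Coalg.of_hom {CD : ColorHopfAlg k G D} {CT : ColorHopfAlg k G T} {α : D →ₗ[k] T}
    (h : IsColorHom k G CD CT α) : Coalg CD CT α := ⟨h.map_comul, h.map_counit⟩

theorem Coalg.conv {CD : ColorHopfAlg k G D} {CT : ColorHopfAlg k G T} {α β : D →ₗ[k] T}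
    (hα : Coalg CD CT α) (hβ : Coalg CD CT β) (h : Kc CD CT α β) :
    Coalg CD CT (conv CD.comul CT.mul α β) := by
  constructor
  · rw [← mul2_conv h, ColorHopfPaper.conv, ← LinearMap.comp_assoc, comul_mul2, LinearMap.comp_assoc,
      mm, hα.comul, hβ.comul]
  · have e1 : CT.counit ∘ₗ CT.mul = (TensorProduct.lid k k).toLinearMap ∘ₗ
        map CT.counit CT.counit := by
      ext x y; simp [CT.counit_mul]
    have e2 : (TensorProduct.lid k k).toLinearMap ∘ₗ map CD.counit CD.counit =
        CD.counit ∘ₗ (TensorProduct.lid k D).toLinearMap ∘ₗ map CD.counit LinearMap.id := by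
      ext x y; simp
    rw [ColorHopfPaper.conv, ← LinearMap.comp_assoc, e1, LinearMap.comp_assoc, mm, hα.counit,
      hβ.counit, ← LinearMap.comp_assoc, e2]
    ext x; simp [CD.counit_left]

theorem conv_antipode_right {CD : ColorHopfAlg k G D} {CT : ColorHopfAlg k G T} {α : D →ₗ[k] T}
    (hα : Coalg CD CT α) :
    conv CD.comul CT.mul α (CT.antipode ∘ₗ α) = cunit CD.counit CT.one := by
  have : map α (CT.antipode ∘ₗ α) ∘ₗ CD.comul = map LinearMap.id CT.antipode ∘ₗ map α α ∘ₗ CD.comul := by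
    rw [mm]; rfl
  rw [conv, this, ← hα.comul, ← hα.counit]
  ext x
  simp [CT.antipode_right, cunit_apply]

theorem conv_antipode_left {CD : ColorHopfAlg k G D} {CT : ColorHopfAlg k G T} {α : D →ₗ[k] T}
    (hα : Coalg CD CT α) :
    conv CD.comul CT.mul (CT.antipode ∘ₗ α) α = cunit CD.counit CT.one := by
  have : map (CT.antipode ∘ₗ α) α ∘ₗ CD.comul = map CT.antipode LinearMap.id ∘ₗ map α α ∘ₗ CD.comul := by
    rw [mm]; rfl
  rw [conv, this, ← hα.comul, ← hα.counit]
  ext x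
  simp [CT.antipode_left, cunit_apply]

theorem Coalg.id (C : ColorHopfAlg k G H) : Coalg C C LinearMap.id :=
  ⟨by simp, by simp⟩

theorem Kc_id (C : ColorHopfAlg k G H) : Kc C C LinearMap.id LinearMap.id :=
  Kc_of_graded rfl (fun _ _ h => h) (fun _ _ h => h)

theorem comul_cunit (CD : ColorHopfAlg k G D) (CT : ColorHopfAlg k G T) :
    CT.comul ∘ₗ cunit CD.counit CT.one = cunit CD.counit (CT.one ⊗ₜ[k] CT.one) := by
  ext x; simp [cunit_apply, CT.comul_one]

theorem map_cunit (CD : ColorHopfAlg k G D) (CT : ColorHopfAlg k G T) :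
    map (cunit CD.counit CT.one) (cunit CD.counit CT.one) ∘ₗ CD.comul =
      cunit CD.counit (CT.one ⊗ₜ[k] CT.one) := by
  have : map (cunit CD.counit CT.one) (cunit CD.counit CT.one) =
      cunit CD.counit (CT.one ⊗ₜ[k] CT.one) ∘ₗ (TensorProduct.lid k D).toLinearMap ∘ₗ
        map CD.counit LinearMap.id := by
    ext x y
    simp [cunit_apply, TensorProduct.tmul_smul, ← TensorProduct.smul_tmul', smul_smul, mul_comm]
  rw [this]
  ext x; simp [CD.counit_left]

theorem antipode_comul (C : ColorHopfAlg k G H) :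
    C.comul ∘ₗ C.antipode = map C.antipode C.antipode ∘ₗ C.comul := by
  set f := C.comul ∘ₗ C.antipode with hf
  set h := map C.antipode C.antipode ∘ₗ C.comul with hh
  have i1 : conv C.comul (mul2 C) f C.comul = cunit C.counit (C.one ⊗ₜ[k] C.one) := by
    have : map f C.comul ∘ₗ C.comul = map C.comul C.comul ∘ₗ map C.antipode LinearMap.id ∘ₗ C.comul := by
      rw [mm]; rfl
    rw [conv, this, ← LinearMap.comp_assoc, ← comul_mul2, ← comul_cunit C C,
      ← conv_antipode_left (Coalg.id C)]
    rfl
  have i2 : conv C.comul (mul2 C) C.comul h = cunit C.counit (C.one ⊗ₜ[k] C.one) := by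
    have := mul2_conv (Kc_antipode (Kc_id C)).symm
    rw [conv_antipode_right (Coalg.id C), map_cunit] at this
    rw [← this, conv, hh]
    simp
  have := conv_assoc C.comul (mul2 C) C.coassoc (mul2_assoc C) f C.comul h
  rw [i1, i2, cunit_conv C _ _ (mul2_one_left C), conv_cunit C _ _ (mul2_one_right C)] at this
  exact this.symm

theorem antipode_counit (C : ColorHopfAlg k G H) : C.counit ∘ₗ C.antipode = C.counit := by
  have e1 : C.counit ∘ₗ C.mul = (TensorProduct.lid k k).toLinearMap ∘ₗ
      map C.counit C.counit := by
    ext x y; simp [C.counit_mul]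
  have e2 : (TensorProduct.lid k k).toLinearMap ∘ₗ map (C.counit ∘ₗ C.antipode) C.counit =
      (C.counit ∘ₗ C.antipode) ∘ₗ (TensorProduct.rid k H).toLinearMap ∘ₗ map LinearMap.id C.counit := by
    ext x y; simp [mul_comm]
  have e3 : C.counit ∘ₗ conv C.comul C.mul C.antipode LinearMap.id = C.counit ∘ₗ C.antipode := by
    rw [conv, ← LinearMap.comp_assoc, e1, LinearMap.comp_assoc, mm, LinearMap.comp_id,
      ← LinearMap.comp_assoc, e2]
    ext x; simp [C.counit_right]
  rw [← e3]
  have := conv_antipode_left (Coalg.id C)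
  rw [LinearMap.comp_id] at this
  rw [this]
  ext x; simp [cunit_apply, C.counit_one]

theorem Coalg.comp {CD : ColorHopfAlg k G D} {CT : ColorHopfAlg k G T} {CH : ColorHopfAlg k G H}
    {β : T →ₗ[k] H} {α : D →ₗ[k] T} (hβ : Coalg CT CH β) (hα : Coalg CD CT α) :
    Coalg CD CH (β ∘ₗ α) := by
  constructor
  · rw [← LinearMap.comp_assoc, hβ.comul, LinearMap.comp_assoc, hα.comul, mm]
  · rw [← LinearMap.comp_assoc, hβ.counit, hα.counit]

theorem Coalg.antipode {CD : ColorHopfAlg k G D} {CT : ColorHopfAlg k G T} {α : D →ₗ[k] T}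
    (hα : Coalg CD CT α) : Coalg CD CT (CT.antipode ∘ₗ α) :=
  Coalg.comp ⟨antipode_comul CT, antipode_counit CT⟩ hα

end Helpers3
section Helpers4

variable {k : Type*} [Field k] {G : Type*} [CommGroup G]
variable {D H T A : Type*} [AddCommGroup D] [Module k D] [AddCommGroup H] [Module k H]
  [AddCommGroup T] [Module k T] [AddCommGroup A] [Module k A]
variable {CD : ColorHopfAlg k G D} {CH : ColorHopfAlg k G H} {CT : ColorHopfAlg k G T}
  {CA : ColorHopfAlg k G A}

theorem hom_id : IsColorHom k G CH CH LinearMap.id :=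
  ⟨by simp, by simp, by simp, by simp, by simp⟩

theorem hom_comp {g : H →ₗ[k] T} {f : D →ₗ[k] H} (hg : IsColorHom k G CH CT g)
    (hf : IsColorHom k G CD CH f) : IsColorHom k G CD CT (g ∘ₗ f) where
  map_mul x y := by simp [hf.map_mul, hg.map_mul]
  map_one := by simp [hf.map_one, hg.map_one]
  map_comul := ((Coalg.of_hom hg).comp (Coalg.of_hom hf)).comul
  map_counit := ((Coalg.of_hom hg).comp (Coalg.of_hom hf)).counit
  map_grade i x hx := hg.map_grade i _ (hf.map_grade i x hx)

theorem hom_mul {f : H →ₗ[k] T} (hf : IsColorHom k G CH CT f) :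
    f ∘ₗ CH.mul = CT.mul ∘ₗ map f f := by
  ext x y; simp [hf.map_mul]

theorem hom_conv {f : H →ₗ[k] T} (hf : IsColorHom k G CH CT f) (α β : D →ₗ[k] H) :
    f ∘ₗ conv CD.comul CH.mul α β = conv CD.comul CT.mul (f ∘ₗ α) (f ∘ₗ β) := by
  rw [conv, conv, ← LinearMap.comp_assoc, hom_mul hf, LinearMap.comp_assoc, mm]

theorem hom_cunit {f : H →ₗ[k] T} (hf : IsColorHom k G CH CT f) :
    f ∘ₗ cunit CD.counit CH.one = cunit CD.counit CT.one := by
  ext x; simp [cunit_apply, hf.map_one]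

theorem hom_antipode {f : H →ₗ[k] T} (hf : IsColorHom k G CH CT f) :
    f ∘ₗ CH.antipode = CT.antipode ∘ₗ f := by
  have i1 : conv CH.comul CT.mul (f ∘ₗ CH.antipode) f = cunit CH.counit CT.one := by
    rw [← hom_cunit hf, ← conv_antipode_left (Coalg.id CH), hom_conv hf]
    rfl
  have i2 := conv_antipode_right (Coalg.of_hom hf)
  have := conv_assoc CH.comul CT.mul CH.coassoc CT.mul_assoc' (f ∘ₗ CH.antipode) f (CT.antipode ∘ₗ f)
  rw [i1, i2, cunit_conv CH _ _ CT.one_mul', conv_cunit CH _ _ CT.mul_one'] at this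
  exact this.symm

theorem map_id_cunit (α : D →ₗ[k] H) (w : T) :
    map α (cunit CD.counit w) ∘ₗ CD.comul = (TensorProduct.mk k H T).flip w ∘ₗ α := by
  have : map α (cunit CD.counit w) = ((TensorProduct.mk k H T).flip w ∘ₗ α) ∘ₗ
      (TensorProduct.rid k D).toLinearMap ∘ₗ map LinearMap.id CD.counit := by
    ext x y; simp [cunit_apply]
  rw [this]
  ext x; simp [CD.counit_right]

theorem mem_hker {α : D →ₗ[k] H} (hα : Coalg CD CH α) {f : H →ₗ[k] T}
    (h : f ∘ₗ α = cunit CD.counit CT.one) (z : D) : α z ∈ CH.hkerOf CT f := by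
  have e : map LinearMap.id f ∘ₗ CH.comul ∘ₗ α = (TensorProduct.mk k H T).flip CT.one ∘ₗ α := by
    rw [hα.comul, mm, h, LinearMap.id_comp, map_id_cunit]
  have := LinearMap.congr_fun e z
  rw [ColorHopfAlg.hkerOf, LinearMap.mem_ker, LinearMap.sub_apply, sub_eq_zero]
  exact this

theorem adj_conv {p q : D →ₗ[k] T} (hp : Coalg CD CT p) (h : Kc CD CT p q) :
    CT.adj ∘ₗ map p q ∘ₗ CD.comul =
      conv CD.comul CT.mul p (conv CD.comul CT.mul q (CT.antipode ∘ₗ p)) := by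
  rw [ColorHopfAlg.adj]
  simp only [LinearMap.comp_assoc]
  rw [mm, hp.comul, LinearMap.id_comp, assoc_map3, mm]
  simp only [LinearMap.comp_assoc]
  rw [h, mm]
  rfl

theorem adj_nat (hφ : CH.φ = CT.φ) {f : H →ₗ[k] T} (hf : IsColorHom k G CH CT f) :
    f ∘ₗ CH.adj = CT.adj ∘ₗ map f f := by
  have e1 : f ∘ₗ CH.mul ∘ₗ map LinearMap.id CH.antipode ∘ₗ CH.braid =
      (CT.mul ∘ₗ map LinearMap.id CT.antipode ∘ₗ CT.braid) ∘ₗ map f f := by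
    rw [← LinearMap.comp_assoc, hom_mul hf, LinearMap.comp_assoc, mm, hom_antipode hf,
      LinearMap.comp_assoc, LinearMap.comp_assoc,
      braid_nat CH CT hφ f f hf.map_grade hf.map_grade, mm]
    rfl
  rw [ColorHopfAlg.adj, ← LinearMap.comp_assoc, hom_mul hf, LinearMap.comp_assoc, mm, e1,
    LinearMap.comp_id]
  rw [ColorHopfAlg.adj]
  simp only [LinearMap.comp_assoc]
  rw [← map_comp, hf.map_comul, LinearMap.id_comp]
  have e2 : map (map f f ∘ₗ CH.comul) f = map (map f f) f ∘ₗ map CH.comul LinearMap.id := by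
    rw [← map_comp, LinearMap.comp_id]
  rw [e2, ← LinearMap.comp_assoc (map CH.comul LinearMap.id) (map (map f f) f), assoc_nat, LinearMap.comp_assoc, mm]
  rfl

/-- The maps generated by homs under convolution and antipode. -/
inductive Gen (CD : ColorHopfAlg k G D) (CT : ColorHopfAlg k G T) : (D →ₗ[k] T) → Prop
  | hom {f} : IsColorHom k G CD CT f → Gen CD CT f
  | mul {f g} : Gen CD CT f → Gen CD CT g → Gen CD CT (conv CD.comul CT.mul f g)
  | inv {f} : Gen CD CT f → Gen CD CT (CT.antipode ∘ₗ f)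

theorem Gen.Kc (hφ : CD.φ = CT.φ) {α β : D →ₗ[k] T} (hα : Gen CD CT α) (hβ : Gen CD CT β) :
    Kc CD CT α β := by
  induction hα with
  | hom hf =>
    induction hβ with
    | hom hg => exact Kc_of_graded hφ hf.map_grade hg.map_grade
    | mul _ _ h1 h2 => exact (Kc_conv h1.symm h2.symm).symm
    | inv _ h1 => exact (Kc_antipode h1.symm).symm
  | mul _ _ h1 h2 => exact Kc_conv h1 h2
  | inv _ h1 => exact Kc_antipode h1

theorem Gen.coalg (hφ : CD.φ = CT.φ) {α : D →ₗ[k] T} (hα : Gen CD CT α) : Coalg CD CT α := by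
  induction hα with
  | hom hf => exact Coalg.of_hom hf
  | mul h1 h2 i1 i2 => exact i1.conv i2 (h1.Kc hφ h2)
  | inv _ h1 => exact h1.antipode

/-- unit of the convolution monoid attached to a coalgebra map -/
noncomputable def un (α : D →ₗ[k] T) (h : Coalg CD CT α) : (Cv CD CT)ˣ where
  val := α
  inv := CT.antipode ∘ₗ α
  val_inv := conv_antipode_right h
  inv_val := conv_antipode_left h

theorem left_hker {f : H →ₗ[k] A} {s : A →ₗ[k] H} (hf : IsColorHom k G CH CA f)
    (hs : IsColorHom k G CA CH s) {y : H} (hy : y ∈ CH.hkerOf CA f) :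
    map (s ∘ₗ f) LinearMap.id (CH.comul y) = CH.one ⊗ₜ[k] y := by
  rw [ColorHopfAlg.hkerOf, LinearMap.mem_ker, LinearMap.sub_apply, sub_eq_zero] at hy
  have h1 : map LinearMap.id (s ∘ₗ f) (CH.comul y) = y ⊗ₜ[k] CH.one := by
    have := congrArg (map LinearMap.id s) hy
    simp only [LinearMap.comp_apply, LinearMap.flip_apply, TensorProduct.mk_apply, map_tmul,
      hs.map_one, LinearMap.id_apply] at this
    rw [← this]
    exact (LinearMap.congr_fun (mm LinearMap.id s LinearMap.id f CH.comul) y).symm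
  have hg := (hom_comp hs hf).map_grade
  have h2 := braid_nat CH CH rfl LinearMap.id (s ∘ₗ f) (fun _ _ h => h) hg
  have h3 := LinearMap.congr_fun h2 (CH.comul y)
  have h4 := LinearMap.congr_fun CH.cocomm y
  simp only [LinearMap.comp_apply] at h3 h4
  rw [h4, h1, braid_one_right] at h3
  exact h3.symm

theorem mul2_map_left {e : H →ₗ[k] H} (he : IsColorHom k G CH CH e) :
    map e LinearMap.id ∘ₗ mul2 CH =
      mul2 CH ∘ₗ map (map e LinearMap.id) (map e LinearMap.id) := by
  apply TensorProduct.ext'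
  intro x y
  simp only [LinearMap.comp_apply, map_tmul]
  induction x using homog_ind2 CH with
  | h i j a ha b hb =>
    induction y using homog_ind2 CH with
    | h i' j' a' ha' b' hb' =>
      rw [mul2_apply CH _ _ _ _ hb ha', map_tmul, map_tmul, LinearMap.id_apply, LinearMap.id_apply,
        mul2_apply CH _ _ _ _ hb (he.map_grade _ _ ha'), map_smul, map_tmul, he.map_mul]
      rfl
    | h0 => simp
    | ha x y h1 h2 => simp only [TensorProduct.tmul_add, map_add, h1, h2]
  | h0 => simp
  | ha x y h1 h2 => simp only [TensorProduct.add_tmul, map_add, h1, h2]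

theorem mul2_one_mid (y : H) : mul2 CH ∘ₗ (TensorProduct.mk k _ _).flip (CH.one ⊗ₜ[k] y) =
    map LinearMap.id (CH.mul ∘ₗ (TensorProduct.mk k _ _).flip y) := by
  ext a b
  simp [mul2, midMap, braid_one_right, CH.mul_one']

theorem eval_aux {f : H →ₗ[k] A} {s : A →ₗ[k] H} (hf : IsColorHom k G CH CA f)
    (hs : IsColorHom k G CA CH s) (hfs : f ∘ₗ s = LinearMap.id) {y : H} (hy : y ∈ CH.hkerOf CA f)
    (x : A) :
    map f LinearMap.id (CH.comul (CH.mul (s x ⊗ₜ[k] y))) =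
      map LinearMap.id (CH.mul ∘ₗ (TensorProduct.mk k _ _).flip y ∘ₗ s) (CA.comul x) := by
  have he := hom_comp hs hf
  have h1 := LinearMap.congr_fun (comul_mul2 CH) (s x ⊗ₜ[k] y)
  simp only [LinearMap.comp_apply, map_tmul] at h1
  have hfe : f = f ∘ₗ (s ∘ₗ f) := by rw [← LinearMap.comp_assoc, hfs, LinearMap.id_comp]
  have h2 : map f (LinearMap.id : H →ₗ[k] H) = map f LinearMap.id ∘ₗ map (s ∘ₗ f) LinearMap.id := by
    rw [← map_comp, ← hfe, LinearMap.comp_id]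
  have h3 := LinearMap.congr_fun (mul2_map_left he) (CH.comul (s x) ⊗ₜ[k] CH.comul y)
  simp only [LinearMap.comp_apply, map_tmul] at h3
  have h4 := LinearMap.congr_fun hs.map_comul x
  simp only [LinearMap.comp_apply] at h4
  have h5 := LinearMap.congr_fun (mul2_one_mid (CH := CH) y)
    (map (s ∘ₗ f) LinearMap.id (CH.comul (s x)))
  simp only [LinearMap.comp_apply, LinearMap.flip_apply, TensorProduct.mk_apply] at h5
  rw [h1, h2, LinearMap.comp_apply, h3, left_hker hf hs hy, h5, h4]
  simp only [← LinearMap.comp_apply]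
  rw [mm, mm, mm]
  simp only [LinearMap.id_comp, LinearMap.comp_assoc, hfs, LinearMap.comp_id]

theorem eval_main {f : H →ₗ[k] A} {s : A →ₗ[k] H} (hf : IsColorHom k G CH CA f)
    (hs : IsColorHom k G CA CH s) (hfs : f ∘ₗ s = LinearMap.id) {y : H} (hy : y ∈ CH.hkerOf CA f)
    (x : A) {h : H →ₗ[k] T} {a : A →ₗ[k] T} (hh : IsColorHom k G CH CT h)
    (ha : IsColorHom k G CA CT a) (hhs : h ∘ₗ s = a) :
    map f (conv CH.comul CT.mul (CT.antipode ∘ₗ a ∘ₗ f) h)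
      (CH.comul (CH.mul (s x ⊗ₜ[k] y))) = x ⊗ₜ[k] h y := by
  have e1 : map f (conv CH.comul CT.mul (CT.antipode ∘ₗ a ∘ₗ f) h) ∘ₗ CH.comul =
      (map LinearMap.id CT.mul ∘ₗ (TensorProduct.assoc k _ _ _).toLinearMap ∘ₗ
        map (map LinearMap.id (CT.antipode ∘ₗ a) ∘ₗ CA.comul) h) ∘ₗ
        map f LinearMap.id ∘ₗ CH.comul := by
    have : map f (conv CH.comul CT.mul (CT.antipode ∘ₗ a ∘ₗ f) h) ∘ₗ CH.comul =
      map LinearMap.id CT.mul ∘ₗ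
        map f (map (CT.antipode ∘ₗ a ∘ₗ f) h ∘ₗ CH.comul) ∘ₗ CH.comul := by
      rw [mm]; rfl
    rw [this, ← assoc_map3]
    simp only [LinearMap.comp_assoc]
    rw [mm, LinearMap.comp_assoc, hf.map_comul, mm]
    rfl
  have e2 := LinearMap.congr_fun e1 (CH.mul (s x ⊗ₜ[k] y))
  simp only [LinearMap.comp_apply] at e2
  rw [e2, eval_aux hf hs hfs hy]
  set R := CH.mul ∘ₗ (TensorProduct.mk k _ _).flip y ∘ₗ s with hR
  have e3 : h ∘ₗ R = (CT.mul ∘ₗ (TensorProduct.mk k _ _).flip (h y)) ∘ₗ a := by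
    rw [← hhs]
    ext u; simp [hR, hh.map_mul]
  have e4 : conv CA.comul CT.mul (CT.antipode ∘ₗ a) (h ∘ₗ R) = cunit CA.counit (h y) := by
    have g1 : CT.mul ∘ₗ map (CT.antipode ∘ₗ a) (h ∘ₗ R) =
        (CT.mul ∘ₗ (TensorProduct.mk k _ _).flip (h y)) ∘ₗ CT.mul ∘ₗ map (CT.antipode ∘ₗ a) a := by
      rw [e3]; ext u v; simp [CT.mul_assoc']
    have g2 := conv_antipode_left (Coalg.of_hom ha)
    rw [conv] at g2
    rw [conv, ← LinearMap.comp_assoc, g1, LinearMap.comp_assoc, LinearMap.comp_assoc, LinearMap.comp_assoc, g2]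
    ext u; simp [cunit_apply, CT.one_mul']
  have e5 : (map LinearMap.id CT.mul ∘ₗ (TensorProduct.assoc k _ _ _).toLinearMap ∘ₗ
        map (map LinearMap.id (CT.antipode ∘ₗ a) ∘ₗ CA.comul) h) ∘ₗ
        map LinearMap.id R ∘ₗ CA.comul = (TensorProduct.mk k A T).flip (h y) := by
    simp only [LinearMap.comp_assoc]
    rw [mm, LinearMap.comp_assoc, LinearMap.comp_id, assoc_map3, mm]
    have : CT.mul ∘ₗ map (CT.antipode ∘ₗ a) (h ∘ₗ R) ∘ₗ CA.comul = cunit CA.counit (h y) := e4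
    rw [this, LinearMap.id_comp, map_id_cunit]
    rfl
  have e6 := LinearMap.congr_fun e5 x
  simp only [LinearMap.comp_apply] at e6
  exact e6

end Helpers4
section Helpers5

variable {k : Type*} [Field k] {G : Type*} [CommGroup G]
variable {D H T : Type*} [AddCommGroup D] [Module k D] [AddCommGroup H] [Module k H]
  [AddCommGroup T] [Module k T]
variable {CD : ColorHopfAlg k G D} {CH : ColorHopfAlg k G H} {CT : ColorHopfAlg k G T}

/-- Postcomposition with a hom, as a monoid hom for convolution. -/
noncomputable def pc (CD : ColorHopfAlg k G D) {f : H →ₗ[k] T} (hf : IsColorHom k G CH CT f) :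
    Cv CD CH →* Cv CD CT where
  toFun α := f ∘ₗ (α : D →ₗ[k] H)
  map_one' := hom_cunit hf
  map_mul' α β := hom_conv hf α β

/-- underlying linear map of a convolution unit -/
def lin (u : (Cv CD CT)ˣ) : D →ₗ[k] T := u.val

/-- the convolution unit of a hom -/
noncomputable def ug {f : D →ₗ[k] T} (hf : IsColorHom k G CD CT f) : (Cv CD CT)ˣ :=
  un f (Coalg.of_hom hf)

theorem pc_ug {f : H →ₗ[k] T} (hf : IsColorHom k G CH CT f) {α : D →ₗ[k] H}
    (hα : IsColorHom k G CD CH α) {β : D →ₗ[k] T} (hβ : IsColorHom k G CD CT β)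
    (h : f ∘ₗ α = β) : Units.map (pc CD hf) (ug hα) = ug hβ :=
  Units.ext h

theorem gen_ug {f : D →ₗ[k] T} (hf : IsColorHom k G CD CT f) :
    Gen CD CT (lin (ug hf)) := Gen.hom hf

theorem gen_ug_inv {f : D →ₗ[k] T} (hf : IsColorHom k G CD CT f) :
    Gen CD CT (lin (ug hf)⁻¹) := Gen.inv (Gen.hom hf)

theorem gen_mul {u v : (Cv CD CT)ˣ} (hu : Gen CD CT (lin u)) (hv : Gen CD CT (lin v)) :
    Gen CD CT (lin (u * v)) := Gen.mul hu hv

theorem adj_ug (hφ : CD.φ = CT.φ) {p : D →ₗ[k] T} (hp : IsColorHom k G CD CT p) (q : (Cv CD CT)ˣ)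
    (hq : Gen CD CT (lin q)) :
    CT.adj ∘ₗ map p (lin q) ∘ₗ CD.comul = lin (ug hp * q * (ug hp)⁻¹) := by
  rw [adj_conv (Coalg.of_hom hp) ((Gen.hom hp).Kc hφ hq), mul_assoc]
  rfl

theorem mem_hker_unit (hφ : CD.φ = CH.φ) (u : (Cv CD CH)ˣ) (hu : Gen CD CH (lin u)) {f : H →ₗ[k] T}
    (hf : IsColorHom k G CH CT f) (h : Units.map (pc CD hf) u = 1) (z : D) :
    lin u z ∈ CH.hkerOf CT f :=
  mem_hker (hu.coalg hφ) (congrArg Units.val h) z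

variable {H0 H1 H2 : Type*} [AddCommGroup H0] [Module k H0] [AddCommGroup H1] [Module k H1]
  [AddCommGroup H2] [Module k H2]
  {C0 : ColorHopfAlg k G H0} {C1 : ColorHopfAlg k G H1} {C2 : ColorHopfAlg k G H2}

theorem part1 {e : H1 →ₗ[k] H0} {t : H0 →ₗ[k] H1}
    (he : IsColorHom k G C1 C0 e) (ht : IsColorHom k G C0 C1 t) (het : e ∘ₗ t = LinearMap.id)
    (a : H0) (x : H1) (hx : x ∈ C1.hkerOf C0 e) :
    C1.adj (t a ⊗ₜ[k] x) ∈ C1.hkerOf C0 e := by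
  have hte := hom_comp ht he
  have hid : IsColorHom k G C1 C1 LinearMap.id := hom_id
  have ev := eval_main he ht het hx a hid ht (LinearMap.id_comp t)
  set z := C1.mul (t a ⊗ₜ[k] x)
  set q : (Cv C1 C1)ˣ := (ug hte)⁻¹ * ug hid with hq
  have hqg : Gen C1 C1 (lin q) := gen_mul (gen_ug_inv _) (gen_ug _)
  have ev2 : map (t ∘ₗ e) (lin q) (C1.comul z) = t a ⊗ₜ[k] x := by
    have := congrArg (map t LinearMap.id) ev
    rw [map_tmul] at this
    have h2 := LinearMap.congr_fun (mm t LinearMap.id e (lin q) C1.comul) z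
    exact h2.symm.trans this
  have h3 := LinearMap.congr_fun (adj_ug rfl hte q hqg) z
  rw [LinearMap.comp_apply, LinearMap.comp_apply, ev2] at h3
  rw [h3]
  have h4 : ug hte * q * (ug hte)⁻¹ = ug hid * (ug hte)⁻¹ := by rw [hq]; group
  rw [h4]
  refine mem_hker_unit rfl _ (gen_mul (gen_ug _) (gen_ug_inv _)) he ?_ z
  rw [map_mul, map_inv, pc_ug he hid he rfl,
    pc_ug he hte he (by rw [← LinearMap.comp_assoc, het, LinearMap.id_comp]), mul_inv_cancel]

theorem part3 (hφ : C2.φ = C1.φ) {d0 d1 d2 : H2 →ₗ[k] H1} {s0 s1 : H1 →ₗ[k] H2}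
    {e0 e1 : H1 →ₗ[k] H0} {t : H0 →ₗ[k] H1}
    (hd0 : IsColorHom k G C2 C1 d0) (hd1 : IsColorHom k G C2 C1 d1) (hd2 : IsColorHom k G C2 C1 d2)
    (hs0 : IsColorHom k G C1 C2 s0) (hs1 : IsColorHom k G C1 C2 s1)
    (he0 : IsColorHom k G C1 C0 e0) (he1 : IsColorHom k G C1 C0 e1) (ht : IsColorHom k G C0 C1 t)
    (d0s0 : d0 ∘ₗ s0 = LinearMap.id) (d1s0 : d1 ∘ₗ s0 = LinearMap.id)
    (d1s1 : d1 ∘ₗ s1 = LinearMap.id) (d2s1 : d2 ∘ₗ s1 = LinearMap.id)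
    (d0s1 : d0 ∘ₗ s1 = t ∘ₗ e0) (d2s0 : d2 ∘ₗ s0 = t ∘ₗ e1) (e0d1 : e0 ∘ₗ d1 = e0 ∘ₗ d0)
    (hlen : ∀ w, w ∈ C2.hkerOf C1 d0 → w ∈ C2.hkerOf C1 d1 → w ∈ Submodule.span k {C2.one})
    (x y : H1) (hy : y ∈ C1.hkerOf C0 e0) :
    C1.adj (x ⊗ₜ[k] y) = C1.adj (t (e1 x) ⊗ₜ[k] y) := by
  have hid : IsColorHom k G C1 C1 LinearMap.id := hom_id
  have hy' : s1 y ∈ C2.hkerOf C1 d0 := by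
    rw [ColorHopfAlg.hkerOf, LinearMap.mem_ker, LinearMap.sub_apply, sub_eq_zero] at hy ⊢
    have h1 : map LinearMap.id d0 ∘ₗ C2.comul ∘ₗ s1 =
        map s1 t ∘ₗ map LinearMap.id e0 ∘ₗ C1.comul := by
      rw [hs1.map_comul, mm, mm, d0s1]; rfl
    have h2 := LinearMap.congr_fun h1 y
    have h3 := congrArg (map s1 t) hy
    refine h2.trans (h3.trans ?_)
    simp [ht.map_one]
  have ev := eval_main hd0 hs0 d0s0 hy' x hd1 hid d1s0
  have hdy : d1 (s1 y) = y := LinearMap.congr_fun d1s1 y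
  rw [hdy] at ev
  set z := C2.mul (s0 x ⊗ₜ[k] s1 y)
  set q : (Cv C2 C1)ˣ := (ug hd0)⁻¹ * ug hd1 with hq
  have hqg : Gen C2 C1 (lin q) := gen_mul (gen_ug_inv _) (gen_ug _)
  have ev1 : map d0 (lin q) (C2.comul z) = x ⊗ₜ[k] y := ev
  have hte := hom_comp ht he1
  have hP := hom_comp hte hd0
  have ev2 : map ((t ∘ₗ e1) ∘ₗ d0) (lin q) (C2.comul z) = t (e1 x) ⊗ₜ[k] y := by
    have := congrArg (map (t ∘ₗ e1) LinearMap.id) ev1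
    rw [map_tmul] at this
    have h2 := LinearMap.congr_fun (mm (t ∘ₗ e1) LinearMap.id d0 (lin q) C2.comul) z
    exact h2.symm.trans this
  have h3 := LinearMap.congr_fun (adj_ug hφ hd0 q hqg) z
  rw [LinearMap.comp_apply, LinearMap.comp_apply, ev1] at h3
  have h4 := LinearMap.congr_fun (adj_ug hφ hP q hqg) z
  rw [LinearMap.comp_apply, LinearMap.comp_apply, ev2] at h4
  rw [h3, h4]
  suffices hs : ug hd0 * q * (ug hd0)⁻¹ = ug hP * q * (ug hP)⁻¹ by rw [hs]
  have a11 := hom_comp hs1 hd1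
  have a10 := hom_comp hs1 hd0
  have a00 := hom_comp hs0 hd0
  set F : (Cv C2 C2)ˣ := ug a11 * (ug a10)⁻¹ * ug a00 * (ug a11)⁻¹ * ug a10 * (ug a00)⁻¹ with hF
  have hFg : Gen C2 C2 (lin F) :=
    gen_mul (gen_mul (gen_mul (gen_mul (gen_mul (gen_ug _) (gen_ug_inv _)) (gen_ug _))
      (gen_ug_inv _)) (gen_ug _)) (gen_ug_inv _)
  have hte0 := hom_comp (hom_comp ht he0) hd0
  have cmp : ∀ {d' : H2 →ₗ[k] H1} {s : H1 →ₗ[k] H2} {r : H1 →ₗ[k] H1} (d : H2 →ₗ[k] H1),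
      d' ∘ₗ s = r → d' ∘ₗ s ∘ₗ d = r ∘ₗ d := by
    intro d' s r d h
    rw [← LinearMap.comp_assoc, h]
  have F0 : Units.map (pc C2 hd0) F = 1 := by
    rw [hF]
    simp only [map_mul, map_inv]
    rw [pc_ug hd0 a11 hte0 (by
        rw [cmp d1 d0s1, LinearMap.comp_assoc, e0d1]; rfl),
      pc_ug hd0 a10 hte0 (cmp d0 d0s1), pc_ug hd0 a00 hd0 (cmp d0 d0s0)]
    group
  have F1 : Units.map (pc C2 hd1) F = 1 := by
    rw [hF]
    simp only [map_mul, map_inv]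
    rw [pc_ug hd1 a11 hd1 (cmp d1 d1s1),
      pc_ug hd1 a10 hd0 (cmp d0 d1s1), pc_ug hd1 a00 hd0 (cmp d0 d1s0)]
    group
  have Fone : F = 1 := by
    apply Units.ext
    change lin F = cunit C2.counit C2.one
    apply LinearMap.ext
    intro w
    obtain ⟨c, hc⟩ := Submodule.mem_span_singleton.1 (hlen _ (mem_hker_unit rfl F hFg hd0 F0 w)
      (mem_hker_unit rfl F hFg hd1 F1 w))
    have h5 := LinearMap.congr_fun (hFg.coalg rfl).counit w
    rw [LinearMap.comp_apply, ← hc, map_smul, C2.counit_one, smul_eq_mul, mul_one] at h5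
    rw [← hc, h5, cunit_apply]
  have F2 : ug hd1 * (ug hd0)⁻¹ * ug hP * (ug hd1)⁻¹ * ug hd0 * (ug hP)⁻¹ = 1 := by
    have := congrArg (Units.map (pc C2 hd2)) Fone
    rw [hF] at this
    simp only [map_mul, map_inv, map_one] at this
    rw [pc_ug hd2 a11 hd1 (cmp d1 d2s1),
      pc_ug hd2 a10 hd0 (cmp d0 d2s1), pc_ug hd2 a00 hP (cmp d0 d2s0)] at this
    exact this
  calc ug hd0 * q * (ug hd0)⁻¹ = (ug hd1 * (ug hd0)⁻¹ * ug hP * (ug hd1)⁻¹ * ug hd0 * (ug hP)⁻¹) *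
        (ug hP * q * (ug hP)⁻¹) := by rw [hq]; group
    _ = _ := by rw [F2, one_mul]

end Helpers5

/-- if the Moore complex of a simplicial cocommutative color Hopf
algebra has length one, then the adjoint action of `M(ℋ)₁ = Hker(d¹₀)` on itself
factors through `∂₁ = d¹₁`: `φ(|x₂|,|y|) x₁ y S(x₂) = ∂₁(x) · y`; consequently
`(H₀, M(ℋ)₁, ∂₁)` is a color Hopf crossed module. -/
theorem moore_length_one_crossed_module (S : SimpColorHopf k G Mo)
    (hlen : ∀ n, 1 ≤ n → S.moore n = Submodule.span k {(S.C (n + 1)).one}) :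
    (∀ a : Mo 0, ∀ x ∈ S.moore 0,
      (S.C 1).adj ((S.s 0 0) a ⊗ₜ[k] x) ∈ S.moore 0) ∧
    (∀ a : Mo 0, ∀ x ∈ S.moore 0,
      (S.d 0 1) ((S.C 1).adj ((S.s 0 0) a ⊗ₜ[k] x)) =
        (S.C 0).adj (a ⊗ₜ[k] (S.d 0 1) x)) ∧
    (∀ x ∈ S.moore 0, ∀ y ∈ S.moore 0,
      (S.C 1).adj (x ⊗ₜ[k] y) =
        (S.C 1).adj ((S.s 0 0) ((S.d 0 1) x) ⊗ₜ[k] y)) := by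
  have m0 : ∀ x, x ∈ S.moore 0 ↔ x ∈ (S.C 1).hkerOf (S.C 0) (S.d 0 0) := by
    intro x
    simp [SimpColorHopf.moore]
  have hd00 := S.d_hom 0 0 (by omega)
  have hd01 := S.d_hom 0 1 (by omega)
  have hs00 := S.s_hom 0 0 (by omega)
  refine ⟨?_, ?_, ?_⟩
  · intro a x hx
    rw [m0] at hx ⊢
    exact part1 hd00 hs00 (S.ds_eq₁ 0 0 (by omega)) a x hx
  · intro a x _
    have h := LinearMap.congr_fun (adj_nat (S.φ_const 0) hd01) ((S.s 0 0) a ⊗ₜ[k] x)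
    rw [LinearMap.comp_apply, LinearMap.comp_apply, map_tmul] at h
    have h2 : (S.d 0 1) ((S.s 0 0) a) = a := LinearMap.congr_fun (S.ds_eq₂ 0 0 (by omega)) a
    rw [h2] at h
    exact h
  · intro x _ y hy
    rw [m0] at hy
    refine part3 (S.φ_const 1) (S.d_hom 1 0 (by omega)) (S.d_hom 1 1 (by omega))
      (S.d_hom 1 2 (by omega)) (S.s_hom 1 0 (by omega)) (S.s_hom 1 1 (by omega)) hd00 hd01 hs00
      (S.ds_eq₁ 1 0 (by omega)) (S.ds_eq₂ 1 0 (by omega)) (S.ds_eq₁ 1 1 (by omega))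
      (S.ds_eq₂ 1 1 (by omega)) (S.ds_lt 0 0 1 (by omega) (by omega))
      (S.ds_gt 0 2 0 (by omega) (by omega)) (S.dd 0 0 1 (by omega) (by omega)) ?_ x y hy
    intro w h0 h1
    rw [← hlen 1 le_rfl]
    simp only [SimpColorHopf.moore, Submodule.mem_iInf, Finset.mem_range]
    intro i hi
    interval_cases i
    · exact h0
    · exact h1

end ColorHopfPaper
end
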